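/- arXiv:2106.04417 — 5 statements merged into one kernel-verified Lean document; each statement's English description precedes it below -/
import Mathlib

section
/- Let T be a finite tree with exactly a leaves, and let S be a subtree of T that has exactly a leaves (as a subgraph, i.e. a vertices of degree 1 in S). Then S contains every vertex of T of degree at least 3 in T. -/
open scoped Classical

noncomputable section

variable {V : Type*}

/-- A coloring `κ : V → ℕ` is proper if adjacent vertices get distinct colors. -/
def Proper (G : SimpleGraph V) (κ : V → ℕ) : Prop :=
  ∀ ⦃u v : V⦄, G.Adj u v → κ u ≠ κ v

/-- The chromatic symmetric function of `G`, as a formal power series in the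
variables `x_0, x_1, x_2, …`: the coefficient of the monomial `∏ i, x_i ^ m i`
is the number of proper colorings `κ : V → ℕ` using color `i` exactly `m i` times. -/
def csf [Fintype V] (G : SimpleGraph V) : MvPowerSeries ℕ ℤ :=
  fun m => (Nat.card {κ : V → ℕ // Proper G κ ∧ ∀ i : ℕ, Nat.card {v : V // κ v = i} = m i} : ℤ)

/-- `A` is (the vertex set of) a subtree of `T`: the induced subgraph on `A` is
connected and has at least one edge. -/
def IsSubtree [Fintype V] (T : SimpleGraph V) (A : Finset V) : Prop :=
  (T.induce (A : Set V)).Connected ∧ ∃ u ∈ A, ∃ v ∈ A, T.Adj u v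

/-- The number of edges of the subgraph of `T` induced on `A`. -/
def edgeCount [Fintype V] (T : SimpleGraph V) (A : Finset V) : ℕ :=
  Nat.card (T.induce (A : Set V)).edgeSet

/-- The number of leaves (vertices of degree 1) of the subgraph of `T` induced on `A`. -/
def leafCount [Fintype V] (T : SimpleGraph V) (A : Finset V) : ℕ :=
  Nat.card {v : (A : Set V) // Nat.card ((T.induce (A : Set V)).neighborSet v) = 1}

/-- The bivariate subtree polynomial `S_T(q, r) = ∑_{subtrees S of T} q^{|E(S)|} r^{|L(S)|}`,
with `q = X 0` and `r = X 1`. -/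
def subtreePoly [Fintype V] (T : SimpleGraph V) : MvPolynomial (Fin 2) ℤ :=
  ∑ A ∈ Finset.univ.powerset.filter (fun A => IsSubtree T A),
    MvPolynomial.X 0 ^ edgeCount T A * MvPolynomial.X 1 ^ leafCount T A

/-- The degree sequence of `T`, as a multiset. -/
def degreeSequence [Fintype V] (T : SimpleGraph V) : Multiset ℕ :=
  Finset.univ.val.map (fun v => T.degree v)

/-- The set of leaves (vertices of degree 1) of `T`. -/
def leaves [Fintype V] (T : SimpleGraph V) : Finset V :=
  Finset.univ.filter (fun v => T.degree v = 1)

/-- `A` is (the vertex set of) the trunk of `T`: the smallest connected induced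
subgraph of `T` containing every vertex of degree at least 3. -/
def IsTrunk [Fintype V] (T : SimpleGraph V) (A : Finset V) : Prop :=
  (T.induce (A : Set V)).Connected ∧ (∀ v : V, 3 ≤ T.degree v → v ∈ A) ∧
    ∀ B : Finset V, (T.induce (B : Set V)).Connected → (∀ v : V, 3 ≤ T.degree v → v ∈ B) →
      A ⊆ B

/-- Every interior (non-endpoint) vertex of the walk `P` has degree 2 in `T`. -/
def InteriorDeg2 [Fintype V] (T : SimpleGraph V) {a b : V} (P : T.Walk a b) : Prop :=
  ∀ v ∈ P.support, v ≠ a → v ≠ b → T.degree v = 2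

/-- `P` is the twig of `l`: the longest path in `T` containing `l` all of whose
interior vertices have degree 2 in `T`. -/
def IsTwig [Fintype V] (T : SimpleGraph V) (l : V) {a b : V} (P : T.Walk a b) : Prop :=
  P.IsPath ∧ l ∈ P.support ∧ InteriorDeg2 T P ∧
    ∀ ⦃a' b' : V⦄ (Q : T.Walk a' b'), Q.IsPath → l ∈ Q.support → InteriorDeg2 T Q →
      Q.length ≤ P.length

/-- The length (number of edges) of the twig of `l`: the maximal length of a path
in `T` containing `l` all of whose interior vertices have degree 2 in `T`. -/
def twigLen [Fintype V] (T : SimpleGraph V) (l : V) : ℕ :=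
  sSup {n : ℕ | ∃ (a b : V) (P : T.Walk a b),
    P.IsPath ∧ l ∈ P.support ∧ InteriorDeg2 T P ∧ P.length = n}

/-- The multiset of lengths of the twigs of `T` (one twig for each leaf). -/
def twigLengths [Fintype V] (T : SimpleGraph V) : Multiset ℕ :=
  (leaves T).val.map (twigLen T)

end

/-- In a finite tree with at least two vertices, the number of leaves exceeds the total
excess of the degrees over `2` by exactly two. -/
theorem SimpleGraph.IsTree.card_leaves_eq {W : Type*} [Fintype W] [Nontrivial W]
    {G : SimpleGraph W} (hG : G.IsTree) :
    (Finset.univ.filter (fun v => G.degree v = 1)).card = 2 + ∑ v, (G.degree v - 2) := by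
  have hE := hG.card_edgeFinset
  have hD := G.sum_degrees_eq_twice_card_edges
  have hpt : ∑ v, (G.degree v + if G.degree v = 1 then 1 else 0)
      = ∑ v, (2 + (G.degree v - 2)) := by
    refine Finset.sum_congr rfl fun v _ => ?_
    have := hG.connected.preconnected.degree_pos_of_nontrivial v
    split_ifs <;> omega
  rw [Finset.sum_add_distrib, Finset.sum_add_distrib, ← Finset.card_filter, hD] at hpt
  simp only [Finset.sum_const, Finset.card_univ, smul_eq_mul] at hpt
  omega

/-- Degrees in an induced subgraph are at most the degrees in the ambient graph. -/
theorem SimpleGraph.degree_induce_le {W : Type*} (G : SimpleGraph W) (s : Set W) (v : s)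
    [Fintype ((G.induce s).neighborSet v)] [Fintype (G.neighborSet v)] :
    (G.induce s).degree v ≤ G.degree v := by
  rw [← SimpleGraph.card_neighborFinset_eq_degree, ← SimpleGraph.card_neighborFinset_eq_degree]
  refine Finset.card_le_card_of_injOn Subtype.val (fun w hw => ?_) Subtype.val_injective.injOn
  simpa using hw

/-- The leaf count of a subtree, in terms of the degrees of its vertices. -/
theorem leafCount_eq {V : Type*} [Fintype V] {T : SimpleGraph V} (hT : T.IsTree) {S : Finset V}
    (hS : IsSubtree T S) :
    leafCount T S = 2 + ∑ v : S, ((T.induce (S : Set V)).degree v - 2) := by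
  obtain ⟨hconn, u, hu, w, hw, huw⟩ := hS
  have : Nontrivial (S : Set V) :=
    ⟨⟨u, hu⟩, ⟨w, hw⟩, fun h => huw.ne (congrArg Subtype.val h)⟩
  have h := (SimpleGraph.IsTree.mk hconn (hT.isAcyclic.induce (S : Set V))).card_leaves_eq
  rw [← Fintype.card_subtype, ← Nat.card_eq_fintype_card] at h
  simp only [← SimpleGraph.card_neighborSet_eq_degree, ← Nat.card_eq_fintype_card] at h ⊢
  rw [leafCount]
  convert h

theorem stmt5 {V : Type*} [Fintype V]
    (T : SimpleGraph V) (hT : T.IsTree) (a : ℕ) (ha : (leaves T).card = a)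
    (S : Finset V) (hS : IsSubtree T S) (hSl : leafCount T S = a) :
    ∀ v : V, 3 ≤ T.degree v → v ∈ S := by
  have : Nontrivial V := by
    obtain ⟨-, u, -, w, -, huw⟩ := hS
    exact ⟨u, w, huw.ne⟩
  have hTl : (leaves T).card = 2 + ∑ v, (T.degree v - 2) := hT.card_leaves_eq
  have hle : leafCount T S ≤ 2 + ∑ v ∈ S, (T.degree v - 2) := by
    rw [leafCount_eq hT hS, ← Finset.sum_coe_sort S fun v => T.degree v - 2]
    refine Nat.add_le_add_left (Finset.sum_le_sum fun v _ => Nat.sub_le_sub_right ?_ 2) 2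
    exact T.degree_induce_le _ v
  intro v hv
  by_contra hvS
  have hlt : ∑ v ∈ S, (T.degree v - 2) < ∑ v, (T.degree v - 2) :=
    Finset.sum_lt_sum_of_subset (Finset.subset_univ S) (Finset.mem_univ v) hvS
      (by omega) (fun _ _ _ => Nat.zero_le _)
  omega
end

section
/- Let T be a finite tree with exactly a leaves, and let S be a subtree of T that has exactly a leaves (as a subgraph, i.e. a vertices of degree 1 in S). Then S contains every edge of T that is incident to some vertex of T of degree at least 3 in T. -/
open scoped Classical

/-- In a finite tree with at least two vertices, the number of leaves is
`2 + ∑ v, max (deg v - 2) 0`. -/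
theorem SimpleGraph.IsTree.card_leaves {W : Type*} [Fintype W] [Nontrivial W]
    {G : SimpleGraph W} (hG : G.IsTree) :
    (Finset.univ.filter fun v => G.degree v = 1).card = 2 + ∑ v, (G.degree v - 2) := by
  have h1 := G.sum_degrees_eq_twice_card_edges
  have h2 := hG.card_edgeFinset
  have h3 : ∀ v, G.degree v + (if G.degree v = 1 then 1 else 0) = (G.degree v - 2) + 2 := by
    intro v
    have := hG.1.preconnected.degree_pos_of_nontrivial v
    split_ifs <;> omega
  have h4 := Finset.sum_congr (rfl : (Finset.univ : Finset W) = _) fun v _ => h3 v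
  rw [Finset.sum_add_distrib, Finset.sum_add_distrib, ← Finset.card_filter] at h4
  simp only [Finset.sum_const, Finset.card_univ, smul_eq_mul] at h4
  omega

theorem SimpleGraph.degree_induce_eq_card_inter {V : Type*} [Fintype V] (T : SimpleGraph V)
    (S : Finset V) (v : (S : Set V)) :
    (T.induce (S : Set V)).degree v = (T.neighborFinset v ∩ S).card := by
  rw [← SimpleGraph.card_neighborFinset_eq_degree,
    ← Finset.card_map (Function.Embedding.subtype _)]
  congr 1
  ext w
  simp

theorem leafCount_eq_card_filter {V : Type*} [Fintype V] (T : SimpleGraph V) (S : Finset V) :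
    leafCount T S =
      (Finset.univ.filter fun v => (T.induce (S : Set V)).degree v = 1).card := by
  rw [leafCount, Nat.card_eq_fintype_card, Fintype.card_subtype]
  congr 1
  ext v
  simp only [Finset.mem_filter, Finset.mem_univ, true_and]
  rw [Nat.card_eq_fintype_card, SimpleGraph.card_neighborSet_eq_degree]

theorem stmt6 {V : Type*} [Fintype V]
    (T : SimpleGraph V) (hT : T.IsTree) (a : ℕ) (ha : (leaves T).card = a)
    (S : Finset V) (hS : IsSubtree T S) (hSl : leafCount T S = a) :
    ∀ u v : V, T.Adj u v → (3 ≤ T.degree u ∨ 3 ≤ T.degree v) → u ∈ S ∧ v ∈ S := by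
  obtain ⟨hconn, x, hx, y, hy, hxy⟩ := hS
  have : Nontrivial V := ⟨x, y, hxy.ne⟩
  have : Nontrivial (S : Set V) := ⟨⟨x, hx⟩, ⟨y, hy⟩, by simpa using hxy.ne⟩
  have hind : (T.induce (S : Set V)).IsTree := ⟨hconn, hT.2.induce _⟩
  have hST : leafCount T S = 2 + ∑ v : (S : Set V), ((T.induce (S : Set V)).degree v - 2) := by
    rw [leafCount_eq_card_filter]
    convert hind.card_leaves
  have hleaves : (leaves T).card = 2 + ∑ v, (T.degree v - 2) := by
    rw [leaves]
    convert hT.card_leaves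
  have hsum : ∑ v : (S : Set V), ((T.induce (S : Set V)).degree v - 2) =
      ∑ v, if v ∈ S then (T.neighborFinset v ∩ S).card - 2 else 0 := by
    simp only [T.degree_induce_eq_card_inter S]
    rw [← Finset.sum_filter, Finset.filter_mem_eq_inter, Finset.univ_inter]
    exact Finset.sum_coe_sort S fun v => (T.neighborFinset v ∩ S).card - 2
  have hcard (v : V) : (T.neighborFinset v ∩ S).card ≤ T.degree v :=
    Finset.card_le_card Finset.inter_subset_left
  have hle : ∀ v ∈ Finset.univ,
      (if v ∈ S then (T.neighborFinset v ∩ S).card - 2 else 0) ≤ T.degree v - 2 := by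
    intro v _
    have := hcard v
    split_ifs <;> omega
  have heq := (Finset.sum_eq_sum_iff_of_le hle).1 (by omega)
  have key : ∀ u v : V, T.Adj u v → 3 ≤ T.degree u → u ∈ S ∧ v ∈ S := by
    intro u v huv hu
    have h := heq u (Finset.mem_univ u)
    split_ifs at h with huS
    · refine ⟨huS, ?_⟩
      have hinter : T.neighborFinset u ∩ S = T.neighborFinset u :=
        Finset.eq_of_subset_of_card_le Finset.inter_subset_left (by
          rw [SimpleGraph.card_neighborFinset_eq_degree]
          omega)
      exact Finset.inter_eq_left.1 hinter ((T.mem_neighborFinset u v).2 huv)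
    · omega
  rintro u v huv (h | h)
  · exact key u v huv h
  · exact (key v u huv.symm h).symm
end

section
/- Let T be a finite tree with at least one vertex of degree at least 3, and let a be its number of leaves. Then the minimum number of vertices among all subtrees of T having exactly a leaves equals |V(T°)| + a, where T° is the trunk of T. -/
open scoped Classical

section InducedDegree

variable {V : Type*} [Fintype V] {T : SimpleGraph V} {B : Finset V} {v : V}

/-- The number of neighbors of `v` in `T` that lie in `B`. -/
noncomputable def degreeIn (T : SimpleGraph V) (B : Finset V) (v : V) : ℕ :=
  (T.neighborFinset v ∩ B).card

lemma degreeIn_le_degree (T : SimpleGraph V) (B : Finset V) (v : V) :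
    degreeIn T B v ≤ T.degree v :=
  Finset.card_le_card Finset.inter_subset_left

lemma degreeIn_eq_degree (h : T.neighborFinset v ⊆ B) : degreeIn T B v = T.degree v := by
  rw [degreeIn, Finset.inter_eq_left.2 h, SimpleGraph.card_neighborFinset_eq_degree]

lemma degree_induce_eq_degreeIn (T : SimpleGraph V) (B : Finset V) (v : (B : Set V)) :
    (T.induce (B : Set V)).degree v = degreeIn T B v := by
  rw [degreeIn, ← SimpleGraph.card_neighborFinset_eq_degree,
    ← Finset.card_map (.subtype (· ∈ (B : Set V)))]
  congr 1
  ext w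
  simp

lemma leafCount_eq_s7 (T : SimpleGraph V) (B : Finset V) :
    leafCount T B = (B.filter fun v => degreeIn T B v = 1).card := by
  have h : ∀ v : (B : Set V),
      Nat.card ((T.induce (B : Set V)).neighborSet v) = degreeIn T B v := fun v => by
    rw [← degree_induce_eq_degreeIn, Nat.card_eq_fintype_card,
      SimpleGraph.card_neighborSet_eq_degree]
  simp only [leafCount, h]
  rw [← Nat.card_eq_finsetCard]
  exact Nat.card_congr ((Equiv.subtypeSubtypeEquivSubtypeInter (· ∈ B) (degreeIn T B · = 1)).trans
    (Equiv.subtypeEquivRight fun _ => by simp))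

lemma leafCount_univ (T : SimpleGraph V) : leafCount T Finset.univ = (leaves T).card := by
  rw [leafCount_eq_s7, leaves]
  simp only [degreeIn_eq_degree (Finset.subset_univ _)]

lemma sum_degreeIn (hT : T.IsTree) (hB : (T.induce (B : Set V)).Connected) :
    ∑ v ∈ B, degreeIn T B v + 2 = 2 * B.card := by
  have htree : (T.induce (B : Set V)).IsTree := ⟨hB, hT.isAcyclic.induce _⟩
  have hedges := htree.card_edgeFinset
  have hsum := (T.induce (B : Set V)).sum_degrees_eq_twice_card_edges
  simp only [degree_induce_eq_degreeIn] at hsum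
  have hcoe : ∑ v : (B : Set V), degreeIn T B v = ∑ v ∈ B, degreeIn T B v :=
    Finset.sum_coe_sort B (degreeIn T B)
  have hcard : Fintype.card (B : Set V) = B.card := Fintype.card_coe B
  omega

lemma degreeIn_pos (hB : (T.induce (B : Set V)).Connected) (hcard : 1 < B.card) (hv : v ∈ B) :
    0 < degreeIn T B v := by
  have : Nontrivial (B : Set V) := (Finset.one_lt_card_iff_nontrivial.1 hcard).coe_sort
  rw [← degree_induce_eq_degreeIn T B ⟨v, hv⟩]
  exact hB.preconnected.degree_pos_of_nontrivial _

/-- In a tree with at least two vertices, the number of leaves is two more than the total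
excess of the vertex degrees over two. -/
lemma leafCount_eq_sum (hT : T.IsTree) (hB : (T.induce (B : Set V)).Connected)
    (hcard : 1 < B.card) : leafCount T B = ∑ v ∈ B, (degreeIn T B v - 2) + 2 := by
  have hsum := sum_degreeIn hT hB
  have hpoint : ∑ v ∈ B, (degreeIn T B v + if degreeIn T B v = 1 then 1 else 0) =
      ∑ v ∈ B, ((degreeIn T B v - 2) + 2) :=
    Finset.sum_congr rfl fun v hv => by
      have := degreeIn_pos hB hcard hv
      split_ifs <;> omega
  rw [Finset.sum_add_distrib, Finset.sum_add_distrib, ← Finset.card_filter, ← leafCount_eq_s7,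
    Finset.sum_const, smul_eq_mul] at hpoint
  omega

lemma connected_erase_leaf (hB : (T.induce (B : Set V)).Connected) (hv : v ∈ B)
    (hdeg : degreeIn T B v = 1) : (T.induce ((B.erase v : Finset V) : Set V)).Connected := by
  rw [← degree_induce_eq_degreeIn T B ⟨v, hv⟩] at hdeg
  refine (hB.induce_compl_singleton_of_degree_eq_one hdeg).map
    ⟨fun w => ⟨w.1.1, ?_⟩, fun h => h⟩ ?_
  · have hw := w.2
    have hwB : w.1.1 ∈ B := w.1.2
    simp only [Set.mem_compl_iff, Set.mem_singleton_iff, Subtype.ext_iff] at hw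
    exact Finset.mem_coe.2 (Finset.mem_erase.2 ⟨hw, hwB⟩)
  · rintro ⟨w, hw⟩
    have hw' := Finset.mem_erase.1 (Finset.mem_coe.1 hw)
    exact ⟨⟨⟨w, hw'.2⟩, fun h => hw'.1 (congrArg Subtype.val h)⟩, rfl⟩

/-- A connected vertex set containing the trunk, with all degrees at least three preserved, has no leaf
inside the trunk. -/
lemma IsTrunk.degreeIn_ne_one {A : Finset V} (hA : IsTrunk T A)
    (hB : (T.induce (B : Set V)).Connected) (hAB : A ⊆ B)
    (hdeg : ∀ v, 3 ≤ T.degree v → degreeIn T B v = T.degree v) (hv : v ∈ A) :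
    degreeIn T B v ≠ 1 := by
  intro h
  have hsub := hA.2.2 (B.erase v) (connected_erase_leaf hB (hAB hv) h) fun w hw =>
    Finset.mem_erase.2 ⟨by rintro rfl; have := hdeg w hw; omega, hAB (hA.2.1 w hw)⟩
  exact Finset.notMem_erase v B (hsub hv)

lemma IsTrunk.leafCount_le_card_sdiff {A : Finset V} (hA : IsTrunk T A)
    (hB : (T.induce (B : Set V)).Connected) (hAB : A ⊆ B)
    (hdeg : ∀ v, 3 ≤ T.degree v → degreeIn T B v = T.degree v) :
    leafCount T B ≤ (B \ A).card := by
  rw [leafCount_eq_s7]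
  refine Finset.card_le_card fun v hv => ?_
  rw [Finset.mem_filter] at hv
  exact Finset.mem_sdiff.2 ⟨hv.1, fun hvA => hA.degreeIn_ne_one hB hAB hdeg hvA hv.2⟩

lemma card_leaves_eq_sum (hT : T.IsTree) (hcard : 1 < Fintype.card V) :
    (leaves T).card = ∑ v, (T.degree v - 2) + 2 := by
  have hconn : (T.induce ((Finset.univ : Finset V) : Set V)).Connected := by
    rw [Finset.coe_univ]
    exact (SimpleGraph.induceUnivIso T).connected_iff.2 hT.connected
  rw [← leafCount_univ, leafCount_eq_sum hT hconn (by simpa using hcard)]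
  simp only [degreeIn_eq_degree (Finset.subset_univ _)]

/-- A subtree with as many leaves as the whole tree retains the degree of every vertex of
degree at least three. -/
lemma degreeIn_eq_degree_of_leafCount_eq (hT : T.IsTree)
    (hB : (T.induce (B : Set V)).Connected) (hcard : 1 < B.card)
    (hleaf : leafCount T B = (leaves T).card) (hv : 3 ≤ T.degree v) :
    v ∈ B ∧ degreeIn T B v = T.degree v := by
  rw [leafCount_eq_sum hT hB hcard,
    card_leaves_eq_sum hT (hcard.trans_le B.card_le_univ)] at hleaf
  have hsum : ∑ w, (if w ∈ B then degreeIn T B w - 2 else 0) = ∑ w, (T.degree w - 2) := by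
    rw [Finset.sum_ite_mem, Finset.univ_inter]
    omega
  have hle : ∀ w ∈ Finset.univ,
      (if w ∈ B then degreeIn T B w - 2 else 0) ≤ T.degree w - 2 := fun w _ => by
    have := degreeIn_le_degree T B w
    split_ifs <;> omega
  have hv' := (Finset.sum_eq_sum_iff_of_le hle).1 hsum v (Finset.mem_univ v)
  split_ifs at hv' with hmem
  · exact ⟨hmem, by omega⟩
  · omega

lemma connected_union_neighbors (hB : (T.induce (B : Set V)).Connected) :
    (T.induce ((B ∪ (B.biUnion fun x => T.neighborFinset x) : Finset V) : Set V)).Connected := by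
  obtain ⟨u, hu⟩ := hB.nonempty
  have huB : u ∈ B := hu
  refine T.induce_connected_of_patches u (by simp [huB]) fun {w} hw => ?_
  rw [Finset.mem_coe, Finset.mem_union, Finset.mem_biUnion] at hw
  obtain hw | ⟨x, hx, hxw⟩ := hw
  · exact ⟨B, by simp, hu, hw, hB.preconnected _ _⟩
  · refine ⟨B ∪ {w}, ?_, Or.inl hu, Or.inr (Set.mem_singleton w), ?_⟩
    · intro y hy
      obtain hy | rfl := hy
      · exact Finset.mem_union_left _ hy
      · exact Finset.mem_union_right _ (Finset.mem_biUnion.2 ⟨x, hx, hxw⟩)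
    · exact (SimpleGraph.connected_induce_union hB.preconnected
        SimpleGraph.Preconnected.of_subsingleton hx (Set.mem_singleton w)
        ((T.mem_neighborFinset _ _).1 hxw)).preconnected _ _

lemma card_neighbors_sdiff_le (hT : T.IsTree) (hB : (T.induce (B : Set V)).Connected) :
    (B.biUnion (fun x => T.neighborFinset x) \ B).card ≤ ∑ v ∈ B, (T.degree v - 2) + 2 := by
  have hsum := sum_degreeIn hT hB
  have hbound : (B.biUnion (fun x => T.neighborFinset x) \ B).card ≤
      ∑ v ∈ B, (T.neighborFinset v \ B).card := by
    refine (Finset.card_le_card fun w hw => ?_).trans Finset.card_biUnion_le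
    simp only [Finset.mem_sdiff, Finset.mem_biUnion] at hw ⊢
    obtain ⟨⟨x, hx, hxw⟩, hw⟩ := hw
    exact ⟨x, hx, hxw, hw⟩
  have hsplit : ∑ v ∈ B, ((T.neighborFinset v \ B).card + degreeIn T B v) ≤
      ∑ v ∈ B, ((T.degree v - 2) + 2) :=
    Finset.sum_le_sum fun v _ => by
      rw [degreeIn, Finset.card_sdiff_add_card_inter, SimpleGraph.card_neighborFinset_eq_degree]
      omega
  rw [Finset.sum_add_distrib, Finset.sum_add_distrib, Finset.sum_const, smul_eq_mul] at hsplit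
  omega

end InducedDegree

theorem stmt7 {V : Type*} [Fintype V]
    (T : SimpleGraph V) (hT : T.IsTree) (hdeg : ∃ v : V, 3 ≤ T.degree v)
    (a : ℕ) (ha : (leaves T).card = a) (A : Finset V) (hA : IsTrunk T A) :
    IsLeast {n : ℕ | ∃ B : Finset V, IsSubtree T B ∧ leafCount T B = a ∧ B.card = n}
      (A.card + a) := by
  subst ha
  constructor
  · set B := A ∪ A.biUnion fun x => T.neighborFinset x with hBdef
    have hAB : A ⊆ B := Finset.subset_union_left
    have hnbr : ∀ v ∈ A, T.neighborFinset v ⊆ B := fun v hv =>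
      (Finset.subset_biUnion_of_mem (fun x => T.neighborFinset x) hv).trans Finset.subset_union_right
    have hB : (T.induce (B : Set V)).Connected := connected_union_neighbors hA.1
    have hpres : ∀ v, 3 ≤ T.degree v → degreeIn T B v = T.degree v := fun v hv =>
      degreeIn_eq_degree (hnbr v (hA.2.1 v hv))
    obtain ⟨u, hu⟩ := hdeg
    have huA := hA.2.1 u hu
    obtain ⟨w, huw⟩ := (T.degree_pos_iff_exists_adj u).1 (by omega)
    have hwB : w ∈ B := hnbr u huA ((T.mem_neighborFinset u w).2 huw)
    have hcard : 1 < B.card := Finset.one_lt_card.2 ⟨u, hAB huA, w, hwB, huw.ne⟩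
    have hleaves := card_leaves_eq_sum hT (hcard.trans_le B.card_le_univ)
    have hsmall : ∀ v ∉ A, T.degree v - 2 = 0 := fun v hv => by
      by_contra h
      exact hv (hA.2.1 v (by omega))
    have hleaf : leafCount T B = (leaves T).card := by
      rw [leafCount_eq_sum hT hB hcard, hleaves,
        ← Finset.sum_subset B.subset_univ fun v _ hv => hsmall v fun h => hv (hAB h)]
      congr 1
      refine Finset.sum_congr rfl fun v _ => ?_
      by_cases hv : 3 ≤ T.degree v
      · rw [hpres v hv]
      · have := degreeIn_le_degree T B v
        omega
    refine ⟨B, ⟨hB, u, hAB huA, w, hwB, huw⟩, hleaf, ?_⟩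
    have hlow := hA.leafCount_le_card_sdiff hB hAB hpres
    have hupp := card_neighbors_sdiff_le hT hA.1
    rw [Finset.sum_subset A.subset_univ fun v _ hv => hsmall v hv, ← hleaves] at hupp
    have hsdiff : B \ A = A.biUnion (fun x => T.neighborFinset x) \ A := by
      rw [hBdef, Finset.union_sdiff_left]
    have := Finset.card_sdiff_add_card_eq_card hAB
    rw [hsdiff] at this hlow
    omega
  · rintro n ⟨B, ⟨hB, u, hu, w, hw, huw⟩, hleaf, rfl⟩
    have hcard : 1 < B.card := Finset.one_lt_card.2 ⟨u, hu, w, hw, huw.ne⟩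
    have hpres := fun v => degreeIn_eq_degree_of_leafCount_eq (v := v) hT hB hcard hleaf
    have hAB := hA.2.2 B hB fun v hv => (hpres v hv).1
    have hle := hA.leafCount_le_card_sdiff hB hAB fun v hv => (hpres v hv).2
    have := Finset.card_sdiff_add_card_eq_card hAB
    omega
end

section
/- Let T be a finite tree with at least one vertex of degree at least 3, let a be its number of leaves, let v = |V(T°)| + a, and let t₁ be the number of twigs of T of length 1. Then the number of subtrees of T with exactly v + 1 vertices and exactly a leaves equals a − t₁. -/
open scoped Classical

namespace SimpleGraph

section Degrees

variable {V : Type*} (T : SimpleGraph V) (S : Finset V)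

/-- The number of neighbours of `v` in `S`. -/
noncomputable def degIn (v : V) : ℕ := (S.filter (T.Adj v)).card

variable {T S}

lemma degIn_univ [Fintype V] (v : V) : T.degIn Finset.univ v = T.degree v := by
  rw [degIn, ← card_neighborFinset_eq_degree]
  congr 1
  ext
  simp

lemma degIn_le_degree [Fintype V] (v : V) : T.degIn S v ≤ T.degree v := by
  rw [← degIn_univ]
  exact Finset.card_le_card (Finset.filter_subset_filter _ (Finset.subset_univ S))

lemma card_neighborSet_induce (v : (S : Set V)) :
    Nat.card ((T.induce (S : Set V)).neighborSet v) = T.degIn S v := by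
  rw [degIn, ← Fintype.card_coe, ← Nat.card_eq_fintype_card]
  exact Nat.card_congr
    ⟨fun w => ⟨w.1.1, Finset.mem_filter.2 ⟨w.1.2, w.2⟩⟩,
      fun w => ⟨⟨w.1, (Finset.mem_filter.1 w.2).1⟩, (Finset.mem_filter.1 w.2).2⟩,
      fun _ => rfl, fun _ => rfl⟩

lemma degIn_insert {u : V} (hu : u ∉ S) (v : V) :
    T.degIn (insert u S) v = T.degIn S v + if T.Adj v u then 1 else 0 := by
  unfold degIn
  rw [Finset.filter_insert]
  split_ifs <;> simp [hu]

lemma adj_mem_of_degree_le_degIn [Fintype V] {v w : V} (h : T.degree v ≤ T.degIn S v)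
    (hvw : T.Adj v w) : w ∈ S := by
  rw [← degIn_univ] at h
  have := Finset.eq_of_subset_of_card_le
    (Finset.filter_subset_filter (T.Adj v) (Finset.subset_univ S)) h
  have hw : w ∈ S.filter (T.Adj v) := by rw [this]; simpa using hvw
  exact (Finset.mem_filter.1 hw).1

lemma degIn_eq_degree [Fintype V] {v : V} (h : ∀ w, T.Adj v w → w ∈ S) :
    T.degIn S v = T.degree v := by
  rw [← degIn_univ]
  unfold degIn
  congr 1
  ext w
  simpa using h w

lemma degIn_pos {v : V} : 0 < T.degIn S v ↔ ∃ w ∈ S, T.Adj v w := by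
  simp [degIn, Finset.card_pos, Finset.Nonempty]

/-- A connected induced subgraph meeting both `X` and its complement has an edge between them. -/
lemma exists_adj_of_connected_induce (hS : (T.induce (S : Set V)).Connected) {X : Set V}
    {x y : V} (hx : x ∈ S) (hy : y ∈ S) (hxX : x ∈ X) (hyX : y ∉ X) :
    ∃ p ∈ S, ∃ q ∈ S, p ∈ X ∧ q ∉ X ∧ T.Adj p q := by
  obtain ⟨w⟩ := hS.preconnected ⟨x, hx⟩ ⟨y, hy⟩
  obtain ⟨d, -, h₁, h₂⟩ := w.exists_boundary_dart (Subtype.val ⁻¹' X) hxX hyX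
  exact ⟨d.fst, d.fst.2, d.snd, d.snd.2, h₁, h₂, d.adj⟩

lemma degIn_pos_of_connected (hS : (T.induce (S : Set V)).Connected) {v w : V} (hv : v ∈ S)
    (hw : w ∈ S) (hvw : w ≠ v) : 0 < T.degIn S v := by
  obtain ⟨p, -, q, hq, rfl, -, h⟩ :=
    exists_adj_of_connected_induce hS (X := {v}) hv hw rfl hvw
  exact degIn_pos.2 ⟨q, hq, h⟩

lemma connected_induce_insert (hS : (T.induce (S : Set V)).Connected) {u p : V} (hp : p ∈ S)
    (h : T.Adj p u) : (T.induce ((insert u S : Finset V) : Set V)).Connected := by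
  have := connected_induce_union (t := {u}) hS.preconnected
    Preconnected.of_subsingleton hp rfl h
  rwa [Set.union_singleton, ← Finset.coe_insert] at this

lemma connected_induce_erase (hS : (T.induce (S : Set V)).Connected) {u w : V}
    (hu : T.degIn S u ≤ 1) (hw : w ∈ S) (hwu : w ≠ u) :
    (T.induce ((S.erase u : Finset V) : Set V)).Connected := by
  have : Nonempty ((S.erase u : Finset V) : Set V) := ⟨⟨w, Finset.mem_erase.2 ⟨hwu, hw⟩⟩⟩
  constructor
  have key := hS.preconnected.induce_of_degree_eq_one (s := {x | x.1 ≠ u}) (by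
    rintro ⟨v, hv⟩ hvu ⟨x, hx⟩ hxv ⟨y, hy⟩ hyv
    obtain rfl : v = u := by simpa using hvu
    exact Subtype.ext (Finset.card_le_one.1 hu x (by simpa using ⟨hx, hxv⟩) y
      (by simpa using ⟨hy, hyv⟩)))
  rintro ⟨x, hx⟩ ⟨y, hy⟩
  obtain ⟨hxu, hxS⟩ := Finset.mem_erase.1 hx
  obtain ⟨hyu, hyS⟩ := Finset.mem_erase.1 hy
  let f : (T.induce (S : Set V)).induce {x | x.1 ≠ u} →g
      T.induce ((S.erase u : Finset V) : Set V) :=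
    ⟨fun z => ⟨z.1.1, Finset.mem_erase.2 ⟨z.2, z.1.2⟩⟩, fun h => h⟩
  exact (key ⟨⟨x, hxS⟩, hxu⟩ ⟨⟨y, hyS⟩, hyu⟩).map f

/-- The handshake identity for a connected set of vertices of a forest. -/
lemma IsAcyclic.sum_degIn (hT : T.IsAcyclic) (hS : (T.induce (S : Set V)).Connected) :
    ∑ v ∈ S, T.degIn S v + 2 = 2 * S.card := by
  have htree : (T.induce (S : Set V)).IsTree := ⟨hS, hT.induce _⟩
  have h₁ := htree.card_edgeFinset
  have h₂ := (T.induce (S : Set V)).sum_degrees_eq_twice_card_edges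
  have h₃ : ∑ v ∈ S, T.degIn S v = ∑ v : (S : Set V), (T.induce (S : Set V)).degree v := by
    rw [← Finset.sum_coe_sort]
    refine Finset.sum_congr rfl fun v _ => ?_
    rw [← card_neighborSet_induce (S := S) v, Nat.card_eq_fintype_card, card_neighborSet_eq_degree]
  simp only [Finset.coe_sort_coe, Fintype.card_coe] at h₁
  omega

lemma IsAcyclic.degIn_eq_one (hT : T.IsAcyclic) (hS : (T.induce (S : Set V)).Connected) {u p : V}
    (hu : u ∉ S) (hp : p ∈ S) (h : T.Adj p u) : T.degIn S u = 1 := by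
  have h₁ := hT.sum_degIn hS
  have h₂ := hT.sum_degIn (connected_induce_insert hS hp h)
  simp only [Finset.sum_insert hu, degIn_insert hu, Finset.sum_add_distrib,
    Finset.card_insert_of_notMem hu, SimpleGraph.irrefl, if_false] at h₂
  have h₃ : ∑ v ∈ S, (if T.Adj v u then 1 else 0) = T.degIn S u := by
    simp [degIn, T.adj_comm u]
  omega

variable [Fintype V]

variable (T S) in
/-- The vertices outside `S` with a neighbour in `S`. -/
noncomputable def outerBoundary : Finset V := Finset.univ.filter fun u => u ∉ S ∧ ∃ p ∈ S, T.Adj p u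

lemma mem_outerBoundary {u : V} : u ∈ T.outerBoundary S ↔ u ∉ S ∧ ∃ p ∈ S, T.Adj p u := by
  simp [outerBoundary]

lemma disjoint_outerBoundary : Disjoint S (T.outerBoundary S) :=
  Finset.disjoint_right.2 fun _ h => (mem_outerBoundary.1 h).1

lemma connected_induce_union_outerBoundary (hS : (T.induce (S : Set V)).Connected) :
    (T.induce ((S ∪ T.outerBoundary S : Finset V) : Set V)).Connected := by
  suffices ∀ F ⊆ T.outerBoundary S, (T.induce ((S ∪ F : Finset V) : Set V)).Connected from
    this _ subset_rfl
  intro F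
  induction F using Finset.induction_on with
  | empty => intro _; rwa [Finset.union_empty]
  | insert u F _ ih =>
    intro h
    obtain ⟨-, p, hp, hpu⟩ := mem_outerBoundary.1 (h (Finset.mem_insert_self u F))
    rw [Finset.union_insert]
    exact connected_induce_insert (ih ((Finset.subset_insert u F).trans h))
      (Finset.mem_union_left _ hp) hpu

lemma IsAcyclic.card_outerBoundary (hT : T.IsAcyclic) (hS : (T.induce (S : Set V)).Connected) :
    (T.outerBoundary S).card + 2 * S.card = ∑ v ∈ S, T.degree v + 2 := by
  have h₁ : ∀ v ∈ S, T.degree v = T.degIn S v + T.degIn (T.outerBoundary S) v := by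
    intro v hv
    rw [← degIn_univ]
    unfold degIn
    rw [← Finset.card_union_of_disjoint
      (Finset.disjoint_filter_filter disjoint_outerBoundary)]
    congr 1
    ext w
    by_cases hw : w ∈ S <;> simp [mem_outerBoundary, hw]
    exact fun h => ⟨v, hv, h⟩
  have h₂ : ∑ v ∈ S, T.degIn (T.outerBoundary S) v = (T.outerBoundary S).card := by
    have := Finset.sum_card_bipartiteAbove_eq_sum_card_bipartiteBelow
      (s := S) (t := T.outerBoundary S) T.Adj
    rw [Finset.card_eq_sum_ones]
    refine this.trans (Finset.sum_congr rfl fun u hu => ?_)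
    obtain ⟨hu, p, hp, hpu⟩ := mem_outerBoundary.1 hu
    rw [← hT.degIn_eq_one hS hu hp hpu]
    simp [degIn, Finset.bipartiteBelow, T.adj_comm u]
  have h₃ := hT.sum_degIn hS
  rw [Finset.sum_congr rfl h₁, Finset.sum_add_distrib, h₂]
  omega

lemma IsAcyclic.leafCount_eq (hT : T.IsAcyclic) (hS : IsSubtree T S) :
    leafCount T S = 2 + ∑ v ∈ S, (T.degIn S v - 2) := by
  obtain ⟨hS, x, hx, y, hy, hxy⟩ := hS
  have h₁ : leafCount T S = ∑ v ∈ S, if T.degIn S v = 1 then 1 else 0 := by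
    rw [leafCount, ← Finset.sum_coe_sort, Nat.card_eq_fintype_card, Fintype.card_subtype,
      Finset.card_filter]
    refine Finset.sum_congr rfl fun v _ => ?_
    rw [card_neighborSet_induce (S := S) v]
  have h₂ : ∀ v ∈ S, (if T.degIn S v = 1 then 1 else 0) + T.degIn S v
      = 2 + (T.degIn S v - 2) := by
    intro v hv
    have : 0 < T.degIn S v := by
      by_cases hxv : x = v
      · exact degIn_pos_of_connected hS hv hy (hxv ▸ hxy.ne')
      · exact degIn_pos_of_connected hS hv hx hxv
    split_ifs <;> omega
  have h₃ := Finset.sum_congr rfl h₂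
  simp only [Finset.sum_add_distrib, Finset.sum_const, smul_eq_mul] at h₃
  have h₄ := hT.sum_degIn hS
  omega

lemma IsTree.card_leaves_s9 (hT : T.IsTree) [Nontrivial V] :
    (leaves T).card = 2 + ∑ v, (T.degree v - 2) := by
  have hconn : (T.induce ((Finset.univ : Finset V) : Set V)).Connected := by
    rw [Finset.coe_univ]
    exact (induceUnivIso T).connected_iff.2 hT.connected
  have h := hT.isAcyclic.sum_degIn hconn
  have h₂ : ∀ v, (if T.degree v = 1 then 1 else 0) + T.degree v = 2 + (T.degree v - 2) := by
    intro v
    have := hT.connected.preconnected.degree_pos_of_nontrivial v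
    split_ifs <;> omega
  have h₃ := Finset.sum_congr (s₁ := Finset.univ) rfl fun v _ => h₂ v
  simp only [Finset.sum_add_distrib, Finset.sum_const, smul_eq_mul] at h₃
  rw [leaves, Finset.card_filter]
  simp only [degIn_univ] at h
  omega

/-- A subtree has as many leaves as the whole tree exactly when it contains every vertex of
degree at least three together with all its neighbours. -/
lemma IsTree.leafCount_eq_card_leaves_iff (hT : T.IsTree) (hS : IsSubtree T S) :
    leafCount T S = (leaves T).card ↔
      ∀ v, 3 ≤ T.degree v → v ∈ S ∧ ∀ w, T.Adj v w → w ∈ S := by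
  have : Nontrivial V := let ⟨_, x, _, y, _, h⟩ := hS; ⟨x, y, h.ne⟩
  have hsum : ∑ v ∈ S, (T.degIn S v - 2) = ∑ v, if v ∈ S then T.degIn S v - 2 else 0 := by
    simp
  rw [hT.isAcyclic.leafCount_eq hS, hT.card_leaves_s9, hsum, Nat.add_left_cancel_iff,
    Finset.sum_eq_sum_iff_of_le fun v _ => by
      have := T.degIn_le_degree (S := S) v
      split_ifs <;> omega]
  refine forall_congr' fun v => ?_
  have hle := T.degIn_le_degree (S := S) v
  constructor
  · intro h hv
    specialize h (Finset.mem_univ v)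
    split_ifs at h with hvS
    · exact ⟨hvS, fun w => adj_mem_of_degree_le_degIn (by omega)⟩
    · omega
  · intro h _
    by_cases hv : 3 ≤ T.degree v
    · rw [if_pos (h hv).1, degIn_eq_degree (h hv).2]
    · split_ifs <;> omega

end Degrees

section Trunk

variable {V : Type*} [Fintype V] {T : SimpleGraph V} {A : Finset V}

lemma _root_.IsTrunk.two_le_degIn (hA : IsTrunk T A) (hdeg : ∃ w, 3 ≤ T.degree w) {v : V}
    (hv : v ∈ A) (hv3 : T.degree v < 3) : 2 ≤ T.degIn A v := by
  obtain ⟨w, hw⟩ := hdeg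
  by_contra! h
  have hne : ∀ u, 3 ≤ T.degree u → u ≠ v := by
    rintro u hu rfl
    omega
  have := hA.2.2 (A.erase v)
    (connected_induce_erase hA.1 (by omega) (hA.2.1 w hw) (hne w hw))
    (fun u hu => Finset.mem_erase.2 ⟨hne u hu, hA.2.1 u hu⟩)
  exact Finset.notMem_erase v A (this hv)

lemma _root_.IsTrunk.three_le_degree (hA : IsTrunk T A) (hdeg : ∃ w, 3 ≤ T.degree w) {p u : V}
    (hp : p ∈ A) (hu : u ∉ A) (h : T.Adj p u) : 3 ≤ T.degree p := by
  by_contra! hp3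
  have := hA.two_le_degIn hdeg hp hp3
  exact hu (adj_mem_of_degree_le_degIn (by omega) h)

lemma _root_.IsTrunk.two_le_degree (hA : IsTrunk T A) (hdeg : ∃ w, 3 ≤ T.degree w) {v : V}
    (hv : v ∈ A) : 2 ≤ T.degree v := by
  by_contra! h
  have := hA.two_le_degIn hdeg hv (by omega)
  have := T.degIn_le_degree (S := A) v
  omega

lemma _root_.IsTrunk.card_outerBoundary (hA : IsTrunk T A) (hT : T.IsTree)
    (hdeg : ∃ w, 3 ≤ T.degree w) : (T.outerBoundary A).card = (leaves T).card := by
  have : Nontrivial V := by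
    obtain ⟨w, hw⟩ := hdeg
    obtain ⟨x, hx⟩ := (T.degree_pos_iff_exists_adj w).1 (by omega)
    exact ⟨w, x, hx.ne⟩
  have h₁ := hT.isAcyclic.card_outerBoundary hA.1
  have h₂ := hT.card_leaves_s9
  have h₃ : ∑ v, (T.degree v - 2) = ∑ v ∈ A, (T.degree v - 2) := by
    refine (Finset.sum_subset (Finset.subset_univ A) fun v _ hv => ?_).symm
    have := mt (hA.2.1 v) hv
    omega
  have h₄ : ∑ v ∈ A, T.degree v = ∑ v ∈ A, ((T.degree v - 2) + 2) :=
    Finset.sum_congr rfl fun v hv => by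
      have := hA.two_le_degree hdeg hv
      omega
  rw [Finset.sum_add_distrib, Finset.sum_const, smul_eq_mul] at h₄
  omega

lemma degree_neighbor_of_degree_eq_one (hT : T.Connected) (hdeg : ∃ w, 3 ≤ T.degree w) {l u : V}
    (hl : T.degree l = 1) (hlu : T.Adj l u) : 2 ≤ T.degree u := by
  by_contra! hu
  obtain ⟨w, hw⟩ := hdeg
  obtain ⟨p⟩ := hT.preconnected l w
  obtain ⟨d, -, hd₁, hd₂⟩ := p.exists_boundary_dart {l, u} (by simp) (by
    rintro (rfl | rfl) <;> omega)
  have key : ∀ x y z : V, T.degree x ≤ 1 → T.Adj x y → T.Adj x z → z = y := by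
    intro x y z hx hy hz
    rw [← card_neighborFinset_eq_degree] at hx
    exact Finset.card_le_one.1 hx z (by simpa) y (by simpa)
  have hadj := d.adj
  obtain h | h : d.fst = l ∨ d.fst = u := hd₁ <;> rw [h] at hadj
  · exact hd₂ (Or.inr (key l u _ (by omega) hlu hadj))
  · exact hd₂ (Or.inl (key u l _ (by omega) hlu.symm hadj))

/-- A leaf has a twig of length one exactly when its neighbour has degree at least three. -/
lemma twigLen_eq_one_iff (hT : T.Connected) (hdeg : ∃ w, 3 ≤ T.degree w) {l u : V}
    (hl : T.degree l = 1) (hlu : T.Adj l u) : twigLen T l = 1 ↔ 3 ≤ T.degree u := by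
  have hu2 := degree_neighbor_of_degree_eq_one hT hdeg hl hlu
  have huniq : ∀ x, T.Adj l x → x = u := by
    intro x hx
    rw [← card_neighborFinset_eq_degree] at hl
    exact Finset.card_le_one.1 hl.le x (by simpa) u (by simpa)
  let L := {n : ℕ | ∃ (a b : V) (P : T.Walk a b),
    P.IsPath ∧ l ∈ P.support ∧ InteriorDeg2 T P ∧ P.length = n}
  have hbdd : BddAbove L := by
    refine ⟨Fintype.card V, ?_⟩
    rintro n ⟨a, b, P, hP, -, -, rfl⟩
    exact hP.length_lt.le
  constructor
  · intro h
    by_contra! hu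
    obtain ⟨x, hx, hxl⟩ : ∃ x, T.Adj u x ∧ x ≠ l := by
      by_contra! hcon
      have : T.degree u ≤ 1 := by
        rw [← card_neighborFinset_eq_degree, Finset.card_le_one]
        intro a ha b hb
        rw [hcon a (by simpa using ha), hcon b (by simpa using hb)]
      omega
    have : 2 ∈ L := by
      refine ⟨l, x, .cons hlu (.cons hx .nil), ?_, by simp, ?_, by simp⟩
      · simp [Walk.cons_isPath_iff, hlu.ne, hx.ne, hxl.symm]
      · intro y hy hyl hyx
        simp [hyl, hyx] at hy
        subst hy
        omega
    have := le_csSup hbdd this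
    change 2 ≤ twigLen T l at this
    omega
  · intro hu
    refine le_antisymm (csSup_le' ?_) (le_csSup hbdd ?_)
    · have key : ∀ {b : V} (P : T.Walk l b), P.IsPath → InteriorDeg2 T P → P.length ≤ 1 := by
        intro b P hP hdeg2
        match P with
        | .nil => simp
        | .cons h .nil => simp
        | .cons (v := y) h (.cons h' Q) =>
          obtain rfl := huniq y h
          have := hdeg2 y (by simp) hlu.ne' (by
            rintro rfl
            simp [Walk.cons_isPath_iff] at hP)
          omega
      rintro n ⟨a, b, P, hP, hlP, hdeg2, rfl⟩
      by_cases ha : l = a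
      · subst ha
        exact key P hP hdeg2
      by_cases hb : l = b
      · subst hb
        rw [← Walk.length_reverse]
        exact key P.reverse hP.reverse fun v hv h₁ h₂ =>
          hdeg2 v (by simpa using hv) h₂ h₁
      · have := hdeg2 l hlP ha hb
        omega
    · refine ⟨l, u, .cons hlu .nil, by simp [hlu.ne], by simp, ?_, by simp⟩
      intro y hy hyl hyu
      simp [hyl, hyu] at hy

lemma _root_.IsTrunk.count_twigLengths (hA : IsTrunk T A) (hT : T.IsTree)
    (hdeg : ∃ w, 3 ≤ T.degree w) :
    (twigLengths T).count 1 = ((T.outerBoundary A).filter fun u => T.degree u = 1).card := by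
  rw [twigLengths, Multiset.count_map, ← Finset.filter_val, Finset.card_val]
  congr 1
  ext l
  simp only [leaves, Finset.mem_filter, Finset.mem_univ, true_and, mem_outerBoundary,
    eq_comm (a := 1)]
  rw [and_comm]
  refine and_congr_left fun hl => ?_
  obtain ⟨u, hlu⟩ := (T.degree_pos_iff_exists_adj l).1 (by omega)
  rw [twigLen_eq_one_iff hT.connected hdeg hl hlu]
  have hlA : l ∉ A := fun h => by
    have := hA.two_le_degree hdeg h
    omega
  refine ⟨fun h => ⟨hlA, u, hA.2.1 u h, hlu.symm⟩, ?_⟩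
  rintro ⟨-, p, hp, hpl⟩
  obtain rfl : p = u := by
    rw [← card_neighborFinset_eq_degree] at hl
    exact Finset.card_le_one.1 hl.le p (by simpa using hpl.symm) u (by simpa)
  exact hA.three_le_degree hdeg hp hlA hpl

/-- The second outer boundary of the trunk has one vertex for each twig of length at least two. -/
lemma _root_.IsTrunk.card_outerBoundary_union (hA : IsTrunk T A) (hT : T.IsTree)
    (hdeg : ∃ w, 3 ≤ T.degree w) :
    (T.outerBoundary (A ∪ T.outerBoundary A)).card
      = (leaves T).card - (twigLengths T).count 1 := by
  have h₁ := hT.isAcyclic.card_outerBoundary hA.1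
  have h₂ := hT.isAcyclic.card_outerBoundary (connected_induce_union_outerBoundary hA.1)
  rw [Finset.sum_union disjoint_outerBoundary, Finset.card_union_of_disjoint
    disjoint_outerBoundary] at h₂
  have h₃ : ∑ u ∈ T.outerBoundary A, (T.degree u + if T.degree u = 1 then 1 else 0)
      = ∑ u ∈ T.outerBoundary A, 2 := by
    refine Finset.sum_congr rfl fun u hu => ?_
    obtain ⟨huA, p, -, hpu⟩ := mem_outerBoundary.1 hu
    have := mt (hA.2.1 u) huA
    have : 0 < T.degree u := hpu.degree_pos_right
    split_ifs <;> omega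
  rw [Finset.sum_add_distrib, ← Finset.card_filter, ← hA.count_twigLengths hT hdeg,
    Finset.sum_const, smul_eq_mul] at h₃
  rw [← hA.card_outerBoundary hT hdeg]
  omega

lemma _root_.IsTrunk.subtree_iff (hA : IsTrunk T A) (hT : T.IsTree)
    (hdeg : ∃ w, 3 ≤ T.degree w) (B : Finset V) :
    (IsSubtree T B ∧ B.card = A.card + (leaves T).card + 1 ∧ leafCount T B = (leaves T).card) ↔
      ∃ x ∈ T.outerBoundary (A ∪ T.outerBoundary A),
        insert x (A ∪ T.outerBoundary A) = B := by
  set N := A ∪ T.outerBoundary A with hN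
  have hcard : N.card = A.card + (leaves T).card := by
    rw [hN, Finset.card_union_of_disjoint disjoint_outerBoundary, hA.card_outerBoundary hT hdeg]
  constructor
  · rintro ⟨hB, hBcard, hleaf⟩
    rw [hT.leafCount_eq_card_leaves_iff hB] at hleaf
    have hNB : N ⊆ B := by
      refine Finset.union_subset (hA.2.2 B hB.1 fun v hv => (hleaf v hv).1) fun u hu => ?_
      obtain ⟨huA, p, hp, hpu⟩ := mem_outerBoundary.1 hu
      exact (hleaf p (hA.three_le_degree hdeg hp huA hpu)).2 u hpu
    obtain ⟨x, hx, rfl⟩ : ∃ x, x ∉ N ∧ insert x N = B := by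
      obtain ⟨x, hx⟩ := Finset.card_eq_one.1
        (show (B \ N).card = 1 by rw [Finset.card_sdiff_of_subset hNB]; omega)
      have hxN : x ∈ B \ N := hx ▸ Finset.mem_singleton_self x
      refine ⟨x, (Finset.mem_sdiff.1 hxN).2, ?_⟩
      rw [Finset.insert_eq, ← hx, Finset.sdiff_union_of_subset hNB]
    obtain ⟨w, hw⟩ := hdeg
    have hwN : w ∈ N := Finset.mem_union_left _ (hA.2.1 w hw)
    obtain ⟨p, hp, q, hq, hpN, hqN, hpq⟩ := exists_adj_of_connected_induce hB.1 (X := N)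
      (Finset.mem_insert_of_mem hwN) (Finset.mem_insert_self x N) hwN hx
    obtain rfl : q = x := (Finset.mem_insert.1 hq).resolve_right hqN
    exact ⟨q, mem_outerBoundary.2 ⟨hx, p, hpN, hpq⟩, rfl⟩
  · rintro ⟨x, hx, rfl⟩
    obtain ⟨hxN, p, hp, hpx⟩ := mem_outerBoundary.1 hx
    have hB : IsSubtree T (insert x N) :=
      ⟨connected_induce_insert (connected_induce_union_outerBoundary hA.1) hp hpx,
        p, Finset.mem_insert_of_mem hp, x, Finset.mem_insert_self x N, hpx⟩
    refine ⟨hB, by rw [Finset.card_insert_of_notMem hxN, hcard],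
      (hT.leafCount_eq_card_leaves_iff hB).2 fun v hv => ?_⟩
    have hvA := hA.2.1 v hv
    refine ⟨Finset.mem_insert_of_mem (Finset.mem_union_left _ hvA), fun w hvw =>
      Finset.mem_insert_of_mem (Finset.mem_union.2 ?_)⟩
    by_cases hw : w ∈ A
    · exact .inl hw
    · exact .inr (mem_outerBoundary.2 ⟨hw, v, hvA, hvw⟩)

end Trunk

end SimpleGraph

theorem stmt9 {V : Type*} [Fintype V]
    (T : SimpleGraph V) (hT : T.IsTree) (hdeg : ∃ w : V, 3 ≤ T.degree w)
    (a : ℕ) (ha : (leaves T).card = a) (A : Finset V) (hA : IsTrunk T A)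
    (v : ℕ) (hv : v = A.card + a)
    (t₁ : ℕ) (ht₁ : t₁ = (twigLengths T).count 1) :
    (Finset.univ.powerset.filter
        (fun B : Finset V => IsSubtree T B ∧ B.card = v + 1 ∧ leafCount T B = a)).card
      = a - t₁ := by
  subst hv ha ht₁
  rw [← hA.card_outerBoundary_union hT hdeg, ← Finset.card_image_of_injOn
    (f := fun x => insert x (A ∪ T.outerBoundary A)) (s := T.outerBoundary (A ∪ T.outerBoundary A))]
  · congr 1
    ext B
    rw [Finset.mem_filter, hA.subtree_iff hT hdeg]
    simp
  · intro x hx y _ hxy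
    exact (Finset.insert_inj (SimpleGraph.mem_outerBoundary.1 hx).1).1 hxy
end

section
/- Let T and T' be finite spiders (trees with exactly one vertex of degree at least 3). If the chromatic symmetric functions of T and T' are equal, i.e. X_T = X_{T'}, then T and T' are isomorphic. -/
open scoped Classical

/-- The weight generating function of the proper colorings of `G` with colors in `C`. -/
noncomputable def colorSum {V C R : Type*} [Fintype V] [Fintype C] [CommRing R]
    (G : SimpleGraph V) (w : C → R) : R :=
  ∑ κ : V → C, if ∀ u v, G.Adj u v → κ u ≠ κ v then ∏ v, w (κ v) else 0

/-- The exponent vector of the monomial of a coloring, with colors encoded by `e`. -/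
noncomputable def content {V C : Type*} [Fintype V] (e : C ↪ ℕ) (κ : V → C) : ℕ →₀ ℕ :=
  ∑ v, Finsupp.single (e (κ v)) 1

theorem content_apply {V C : Type*} [Fintype V] (e : C ↪ ℕ) (κ : V → C) (i : ℕ) :
    content e κ i = Nat.card {v : V // e (κ v) = i} := by
  simp [content, Finsupp.finsetSum_apply, Finsupp.single_apply, Fintype.card_subtype]

theorem content_support {V C : Type*} [Fintype V] (e : C ↪ ℕ) (κ : V → C) (i : ℕ)
    (hi : content e κ i ≠ 0) : i ∈ Set.range e := by
  rw [content_apply] at hi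
  obtain ⟨⟨v, hv⟩⟩ := (Nat.card_ne_zero.mp hi).1
  exact ⟨κ v, hv⟩

theorem prod_content {V C R : Type*} [Fintype V] [CommRing R] (e : C ↪ ℕ) (κ : V → C)
    (w : C → R) :
    ∏ v, w (κ v) = (content e κ).prod (fun i k => Function.extend e w 0 i ^ k) := by
  rw [content, ← Finsupp.prod_finsetSum_index (by simp) (by intros; rw [pow_add])]
  refine Finset.prod_congr rfl fun v _ => ?_
  rw [Finsupp.prod_single_index (by simp), pow_one, e.injective.extend_apply]

theorem card_content_eq_csf {V C : Type*} [Fintype V] [Fintype C] (G : SimpleGraph V)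
    (e : C ↪ ℕ) (m : ℕ →₀ ℕ) (hm : ∀ i, m i ≠ 0 → i ∈ Set.range e) :
    (Nat.card {κ : V → C // (∀ u v, G.Adj u v → κ u ≠ κ v) ∧ content e κ = m} : ℤ) =
      csf G m := by
  unfold csf
  congr 1
  refine Nat.card_congr (Equiv.ofBijective
    (fun κ => ⟨fun v => e (κ.1 v), fun u v huv h => κ.2.1 u v huv (e.injective h), fun i => by
      simpa only [κ.2.2] using (content_apply e κ.1 i).symm⟩) ⟨?_, ?_⟩)
  · rintro ⟨κ, h⟩ ⟨κ', h'⟩ heq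
    ext v
    exact e.injective (congrFun (congrArg Subtype.val heq) v)
  · rintro ⟨κ, hκ, hc⟩
    have hr : ∀ v, ∃ c, e c = κ v := fun v => hm _ (by
      rw [← hc]
      have : Nonempty {u // κ u = κ v} := ⟨v, rfl⟩
      exact Nat.card_pos.ne')
    choose κ' hκ' using hr
    refine ⟨⟨κ', fun u v huv h => hκ huv (by rw [← hκ', ← hκ', h]), ?_⟩, ?_⟩
    · ext i
      rw [content_apply, ← hc]
      simp [hκ']
    · ext v
      exact hκ' v

theorem colorSum_eq_sum_csf {V C R : Type*} [Fintype V] [Fintype C] [CommRing R]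
    (G : SimpleGraph V) (w : C → R) (e : C ↪ ℕ) (I : Finset (ℕ →₀ ℕ))
    (hI : ∀ κ : V → C, content e κ ∈ I) (hI' : ∀ m ∈ I, ∀ i, m i ≠ 0 → i ∈ Set.range e) :
    colorSum G w =
      ∑ m ∈ I, (csf G m : R) * m.prod (fun i k => Function.extend e w 0 i ^ k) := by
  rw [colorSum, ← Finset.sum_fiberwise_of_maps_to (t := I) (g := content e) fun κ _ => hI κ]
  refine Finset.sum_congr rfl fun m hm => ?_
  rw [← card_content_eq_csf G e m (hI' m hm), Finset.sum_ite, Finset.sum_const_zero, add_zero,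
    Finset.filter_filter, Finset.sum_congr rfl (g := fun _ =>
      m.prod (fun i k => Function.extend e w 0 i ^ k)), Finset.sum_const, nsmul_eq_mul]
  · congr 1
    rw [Nat.card_eq_fintype_card, Fintype.card_subtype]
    simp only [and_comm, Int.cast_natCast]
  · intro κ hκ
    rw [prod_content e, (Finset.mem_filter.mp hκ).2.1]

theorem colorSum_eq_of_csf_eq {V V' C R : Type*} [Fintype V] [Fintype V'] [Fintype C]
    [CommRing R] {G : SimpleGraph V} {G' : SimpleGraph V'} (h : csf G = csf G') (w : C → R) :
    colorSum G w = colorSum G' w := by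
  let e : C ↪ ℕ := (Fintype.equivFin C).toEmbedding.trans Fin.valEmbedding
  let I := Finset.univ.image (content (V := V) e) ∪ Finset.univ.image (content (V := V') e)
  have hI : ∀ m ∈ I, ∀ i, m i ≠ 0 → i ∈ Set.range e := by
    intro m hm
    simp only [I, Finset.mem_union, Finset.mem_image, Finset.mem_univ, true_and] at hm
    obtain ⟨κ, rfl⟩ | ⟨κ, rfl⟩ := hm <;> exact content_support e κ
  rw [colorSum_eq_sum_csf G w e I (by simp [I]) hI, colorSum_eq_sum_csf G' w e I (by simp [I]) hI,
    h]

theorem csf_congr_iso {V V' : Type*} [Fintype V] [Fintype V'] {G : SimpleGraph V}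
    {G' : SimpleGraph V'} (φ : G ≃g G') : csf G = csf G' := by
  funext m
  unfold csf
  congr 1
  refine Nat.card_congr
    (Equiv.subtypeEquiv (φ.toEquiv.arrowCongr (Equiv.refl ℕ)) fun κ => and_congr ?_ ?_)
  · constructor
    · intro h u v huv
      exact h (φ.symm.map_adj_iff.mpr huv)
    · intro h u v huv
      have := h (φ.map_adj_iff.mpr huv)
      change κ (φ.toEquiv.symm (φ.toEquiv u)) ≠ κ (φ.toEquiv.symm (φ.toEquiv v)) at this
      simpa only [Equiv.symm_apply_apply] using this
  · refine forall_congr' fun i => Eq.congr_left (Nat.card_congr ?_)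
    exact φ.toEquiv.subtypeEquiv fun v => by
      simp only [Equiv.arrowCongr_apply, Equiv.coe_refl, Function.comp_apply,
        Equiv.symm_apply_apply, id]

theorem card_eq_of_csf_eq {V V' : Type*} [Fintype V] [Fintype V']
    {G : SimpleGraph V} {G' : SimpleGraph V'} (h : csf G = csf G') :
    Fintype.card V = Fintype.card V' := by
  have h1 := colorSum_eq_of_csf_eq h (fun _ : V => (1 : ℤ))
  have h2 := colorSum_eq_of_csf_eq h (fun _ : V => (2 : ℤ))
  have hpos : colorSum G (fun _ : V => (1 : ℤ)) ≠ 0 := by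
    refine (Finset.sum_pos' (fun κ _ => ?_) ⟨id, Finset.mem_univ _, ?_⟩).ne'
    · split_ifs <;> simp
    · rw [if_pos fun u v huv => huv.ne]
      simp
  have hc : colorSum G (fun _ : V => (2 : ℤ)) =
      2 ^ Fintype.card V * colorSum G (fun _ : V => (1 : ℤ)) := by
    simp only [colorSum, Finset.mul_sum, mul_ite, Finset.prod_const, one_pow, mul_one, mul_zero,
      Finset.card_univ]
  have hc' : colorSum G' (fun _ : V => (2 : ℤ)) =
      2 ^ Fintype.card V' * colorSum G' (fun _ : V => (1 : ℤ)) := by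
    simp only [colorSum, Finset.mul_sum, mul_ite, Finset.prod_const, one_pow, mul_one, mul_zero,
      Finset.card_univ]
  rw [hc, hc', ← h1] at h2
  exact Nat.pow_right_injective le_rfl (by exact_mod_cast mul_right_cancel₀ hpos h2)

/-- The neighbor of a leg vertex of a spider on the side of the center `none`. -/
def spiderParent {ι : Type*} (ℓ : ι → ℕ) (x : Σ i, Fin (ℓ i)) : Option (Σ i, Fin (ℓ i)) :=
  if h : x.2.1 = 0 then none else some ⟨x.1, ⟨x.2.1 - 1, by omega⟩⟩

theorem spiderParent_ne {ι : Type*} (ℓ : ι → ℕ) (x : Σ i, Fin (ℓ i)) :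
    some x ≠ spiderParent ℓ x := by
  obtain ⟨i, j⟩ := x
  unfold spiderParent
  split_ifs with h
  · simp
  · simp only [ne_eq, Option.some.injEq, Sigma.mk.injEq, heq_eq_eq, true_and, Fin.ext_iff]
    simp only at h
    omega

/-- The spider with center `none` and a leg of length `ℓ i` for every `i`. -/
def spider {ι : Type*} (ℓ : ι → ℕ) : SimpleGraph (Option (Σ i, Fin (ℓ i))) where
  Adj u v := (∃ x, u = some x ∧ v = spiderParent ℓ x) ∨ ∃ x, v = some x ∧ u = spiderParent ℓ x
  symm := ⟨fun _ _ h => h.symm⟩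
  loopless := ⟨by
    rintro u (⟨x, rfl, h⟩ | ⟨x, rfl, h⟩) <;> exact spiderParent_ne ℓ x h⟩

/-- The weight generating function of the proper colorings of a path with `l` vertices, the
first of which must also avoid the color `c`. -/
noncomputable def legSum {C R : Type*} [Fintype C] [CommRing R] (w : C → R) : ℕ → C → R
  | 0, _ => 1
  | l + 1, c => ∑ d, if d = c then 0 else w d * legSum w l d

theorem legSum_eq {C R : Type*} [Fintype C] [CommRing R] (w : C → R) (l : ℕ) (c : C) :
    legSum w l c = ∑ g : Fin l → C, ∏ j : Fin l,
      if g j = (Fin.cons c g : Fin (l + 1) → C) j.castSucc then 0 else w (g j) := by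
  induction l generalizing c with
  | zero => simp [legSum]
  | succ l ih =>
    rw [legSum, ← (Fin.consEquiv fun _ => C).sum_comp, Fintype.sum_prod_type]
    refine Finset.sum_congr rfl fun d _ => ?_
    simp only [Fin.consEquiv, Equiv.coe_fn_mk, Fin.prod_univ_succ, Fin.cons_zero, Fin.cons_succ,
      Fin.castSucc_zero, ← Fin.succ_castSucc, ← Finset.mul_sum, ← ih]
    split_ifs <;> simp

theorem apply_spiderParent {ι C : Type*} (ℓ : ι → ℕ) (κ : Option (Σ i, Fin (ℓ i)) → C) (i : ι)
    (j : Fin (ℓ i)) : κ (spiderParent ℓ ⟨i, j⟩) =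
      (Fin.cons (κ none) (fun j => κ (some ⟨i, j⟩)) : Fin (ℓ i + 1) → C) j.castSucc := by
  obtain ⟨j, hj⟩ := j
  cases j with
  | zero => simp [spiderParent]
  | succ j =>
    have : (⟨j + 1, hj⟩ : Fin (ℓ i)).castSucc = Fin.succ ⟨j, by omega⟩ := rfl
    rw [this, Fin.cons_succ]
    simp [spiderParent]

theorem colorSum_spider {ι C R : Type*} [Fintype ι] [Fintype C] [CommRing R] (ℓ : ι → ℕ)
    (w : C → R) : colorSum (spider ℓ) w = ∑ c, w c * ∏ i, legSum w (ℓ i) c := by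
  have h1 : colorSum (spider ℓ) w = ∑ κ : Option (Σ i, Fin (ℓ i)) → C, w (κ none) *
      ∏ x, if κ (some x) = κ (spiderParent ℓ x) then 0 else w (κ (some x)) := by
    refine Finset.sum_congr (Finset.ext fun _ => by simp) fun κ _ => ?_
    split_ifs with h
    · rw [Fintype.prod_option]
      congr 1
      exact Finset.prod_congr rfl fun x _ => (if_neg (h _ _ (Or.inl ⟨x, rfl, rfl⟩))).symm
    · rw [eq_comm]
      push Not at h
      obtain ⟨u, v, huv, he⟩ := h
      obtain ⟨x, hx⟩ : ∃ x, κ (some x) = κ (spiderParent ℓ x) := by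
        obtain ⟨x, rfl, rfl⟩ | ⟨x, rfl, rfl⟩ := huv
        exacts [⟨x, he⟩, ⟨x, he.symm⟩]
      exact mul_eq_zero_of_right _ (Finset.prod_eq_zero (Finset.mem_univ x) (if_pos hx))
  let e : (Option (Σ i, Fin (ℓ i)) → C) ≃ C × (∀ i, Fin (ℓ i) → C) :=
    { toFun := fun κ => (κ none, fun i j => κ (some ⟨i, j⟩))
      invFun := fun p u => u.elim p.1 fun x => p.2 x.1 x.2
      left_inv := fun κ => by ext u; cases u <;> rfl
      right_inv := fun p => rfl }
  rw [h1, ← e.symm.sum_comp, Fintype.sum_prod_type]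
  refine Finset.sum_congr rfl fun c _ => ?_
  simp only [legSum_eq, Finset.prod_univ_sum, Fintype.piFinset_univ, Finset.mul_sum]
  refine Finset.sum_congr rfl fun g _ => ?_
  rw [Fintype.prod_sigma]
  simp only [apply_spiderParent]
  rfl

/-- For `t` colors of weight `1` and `t` colors of weight `q`, the weight generating function
of the proper colorings of a path with `l` vertices, the first of which must also avoid a given
color of weight `1` (for `false`) or `q` (for `true`). -/
def legPoly {S : Type*} [CommRing S] (t q : S) : ℕ → Bool → S
  | 0, _ => 1
  | l + 1, b => t * (legPoly t q l false + q * legPoly t q l true) -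
      (bif b then q else 1) * legPoly t q l b

theorem map_legPoly {S S' : Type*} [CommRing S] [CommRing S'] (f : S →+* S') (t q : S) (l : ℕ)
    (b : Bool) : f (legPoly t q l b) = legPoly (f t) (f q) l b := by
  induction l generalizing b with
  | zero => simp [legPoly]
  | succ l ih => cases b <;> simp [legPoly, ih]

theorem legSum_succ {C R : Type*} [Fintype C] [CommRing R] (w : C → R) (l : ℕ) (c : C) :
    legSum w (l + 1) c = ∑ d, w d * legSum w l d - w c * legSum w l c := by
  rw [legSum, eq_sub_iff_add_eq, ← Finset.sum_erase_add _ _ (Finset.mem_univ c),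
    ← Finset.sum_erase_add _ (fun d => w d * legSum w l d) (Finset.mem_univ c), if_pos rfl,
    add_zero]
  congr 1
  exact Finset.sum_congr rfl fun d hd => if_neg (Finset.ne_of_mem_erase hd)

theorem legSum_two_weights {R : Type*} [CommRing R] (t : ℕ) (q : R) (l : ℕ) (c : Bool × Fin t) :
    legSum (fun c : Bool × Fin t => bif c.1 then q else 1) l c = legPoly (t : R) q l c.1 := by
  induction l generalizing c with
  | zero => rfl
  | succ l ih =>
    rw [legSum_succ, Fintype.sum_prod_type]
    simp only [ih, legPoly]
    simp
    ring

theorem colorSum_spider_two_weights {ι R : Type*} [Fintype ι] [CommRing R] (ℓ : ι → ℕ) (t : ℕ)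
    (q : R) : colorSum (spider ℓ) (fun c : Bool × Fin t => bif c.1 then q else 1) =
      t * (∏ i, legPoly (t : R) q (ℓ i) false + q * ∏ i, legPoly (t : R) q (ℓ i) true) := by
  rw [colorSum_spider, Fintype.sum_prod_type]
  simp only [legSum_two_weights]
  simp
  ring

theorem legPoly_dualNumber {K : Type*} [Field K] {q : K} (hq : q ≠ 0) (l : ℕ) (b : Bool) :
    legPoly (DualNumber.eps : DualNumber K) (TrivSqZeroExt.inl q) l b =
      TrivSqZeroExt.inl ((-(bif b then q else 1)) ^ l) *
        (1 + TrivSqZeroExt.inr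
          (-∑ j ∈ Finset.range l, (1 + (bif b then q⁻¹ else q) ^ (j + 1)))) := by
  induction l generalizing b with
  | zero => simp [legPoly]
  | succ l ih =>
    rw [legPoly, ih, ih, ih, Finset.sum_range_succ]
    ext
    · cases b <;> simp [pow_succ, mul_comm]
    · cases b
      · simp
        ring
      · simp [inv_pow]
        field_simp
        ring

theorem prod_inl_mul_one_add_inr {ι K : Type*} [Field K] (s : Finset ι) (c α : ι → K) :
    ∏ i ∈ s, ((TrivSqZeroExt.inl (c i) : DualNumber K) * (1 + TrivSqZeroExt.inr (α i))) =
      TrivSqZeroExt.inl (∏ i ∈ s, c i) * (1 + TrivSqZeroExt.inr (∑ i ∈ s, α i)) := by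
  induction s using Finset.induction_on with
  | empty => simp
  | insert a s ha ih =>
    rw [Finset.prod_insert ha, Finset.prod_insert ha, Finset.sum_insert ha, ih]
    ext
    · simp
    · simp
      ring

open Polynomial in
theorem polynomial_eq_of_csf_eq {ι ι' : Type*} [Fintype ι] [Fintype ι'] {ℓ : ι → ℕ} {ℓ' : ι' → ℕ}
    (h : csf (spider ℓ) = csf (spider ℓ')) (q : ℚ) :
    ∏ i, legPoly (X : ℚ[X]) (C q) (ℓ i) false + C q * ∏ i, legPoly X (C q) (ℓ i) true =
      ∏ i, legPoly (X : ℚ[X]) (C q) (ℓ' i) false + C q * ∏ i, legPoly X (C q) (ℓ' i) true := by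
  refine Polynomial.eq_of_infinite_eval_eq _ _ (Set.Infinite.mono ?_
    (Set.infinite_range_of_injective (f := fun n : ℕ => ((n + 1 : ℕ) : ℚ))
      fun a b hab => by simpa using hab))
  rintro _ ⟨n, rfl⟩
  have h1 := colorSum_eq_of_csf_eq h (fun c : Bool × Fin (n + 1) => bif c.1 then q else 1)
  rw [colorSum_spider_two_weights, colorSum_spider_two_weights] at h1
  have h2 := mul_left_cancel₀ (by positivity) h1
  have he : ∀ l b, eval ((n + 1 : ℕ) : ℚ) (legPoly X (C q) l b) =
      legPoly (((n + 1 : ℕ) : ℚ)) q l b := fun l b => by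
    have := map_legPoly (evalRingHom ((n + 1 : ℕ) : ℚ)) X (C q) l b
    simpa only [coe_evalRingHom, eval_X, eval_C] using this
  simpa only [Set.mem_ofPred_eq, eval_add, eval_mul, eval_prod, eval_C, he] using h2

open Polynomial in
theorem snd_aeval_eps {κ : Type*} [Fintype κ] (m : κ → ℕ) {S : ℕ} (hm : ∑ i, m i = S) {q : ℚ}
    (hq : q ≠ 0) :
    TrivSqZeroExt.snd (aeval (DualNumber.eps : DualNumber ℚ)
      (∏ i, legPoly (X : ℚ[X]) (C q) (m i) false + C q * ∏ i, legPoly X (C q) (m i) true)) =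
    (-1) ^ (S + 1) * (S + q ^ (S + 1) * S +
      ∑ i, ∑ j ∈ Finset.range (m i), (q ^ (j + 1) + q ^ (S - j))) := by
  have halg : algebraMap ℚ (DualNumber ℚ) q = TrivSqZeroExt.inl q := rfl
  have he : ∀ l b, aeval (DualNumber.eps : DualNumber ℚ) (legPoly X (C q) l b) =
      legPoly DualNumber.eps (TrivSqZeroExt.inl q) l b := fun l b => by
    have := map_legPoly (aeval (DualNumber.eps : DualNumber ℚ)).toRingHom X (C q) l b
    simpa [halg] using this
  have hx : ∀ i, ∑ j ∈ Finset.range (m i), (q ^ (j + 1) + q ^ (S - j)) =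
      ∑ j ∈ Finset.range (m i), q ^ (j + 1) +
        q ^ (S + 1) * ∑ j ∈ Finset.range (m i), q⁻¹ ^ (j + 1) := by
    intro i
    rw [Finset.sum_add_distrib, Finset.mul_sum]
    congr 1
    refine Finset.sum_congr rfl fun j hj => ?_
    have h1 : m i ≤ S := hm ▸ Finset.single_le_sum (fun _ _ => Nat.zero_le _) (Finset.mem_univ i)
    have h2 := Finset.mem_range.mp hj
    rw [show S + 1 = (S - j) + (j + 1) by omega, pow_add, mul_assoc, ← mul_pow,
      mul_inv_cancel₀ hq, one_pow, mul_one]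
  have hc : (∑ i, (m i : ℚ)) = S := by exact_mod_cast hm
  simp only [map_add, map_mul, map_prod, he, legPoly_dualNumber hq, prod_inl_mul_one_add_inr,
    Finset.prod_pow_eq_pow_sum, hm, hx, aeval_C, halg]
  simp [Finset.sum_add_distrib, hc, ← Finset.mul_sum]
  rw [neg_pow q]
  ring

open Polynomial in
theorem sum_pow_eq_of_csf_eq {ι ι' : Type*} [Fintype ι] [Fintype ι'] {ℓ : ι → ℕ} {ℓ' : ι' → ℕ}
    (h : csf (spider ℓ) = csf (spider ℓ')) (S : ℕ) (hS : ∑ i, ℓ i = S) (hS' : ∑ i, ℓ' i = S)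
    {q : ℚ} (hq : q ≠ 0) :
    ∑ i, ∑ j ∈ Finset.range (ℓ i), (q ^ (j + 1) + q ^ (S - j)) =
      ∑ i, ∑ j ∈ Finset.range (ℓ' i), (q ^ (j + 1) + q ^ (S - j)) := by
  have h1 := congrArg (fun p => TrivSqZeroExt.snd (aeval (DualNumber.eps : DualNumber ℚ) p))
    (polynomial_eq_of_csf_eq h q)
  beta_reduce at h1
  rw [snd_aeval_eps ℓ hS hq, snd_aeval_eps ℓ' hS' hq] at h1
  exact add_left_cancel (mul_left_cancel₀ (pow_ne_zero _ (by norm_num)) h1)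

open Polynomial in
theorem coeff_sum_X_pow {κ : Type*} [Fintype κ] (m : κ → ℕ) {S : ℕ} (hm : ∑ i, m i = S) (a : ℕ)
    (ha : 1 ≤ a) (haS : a ≤ S) :
    coeff (∑ i, ∑ j ∈ Finset.range (m i), ((X : ℚ[X]) ^ (j + 1) + X ^ (S - j))) a =
    (((Finset.univ.filter fun i => a ≤ m i).card +
      (Finset.univ.filter fun i => S + 1 - a ≤ m i).card : ℕ) : ℚ) := by
  simp only [finsetSum_coeff, coeff_add, coeff_X_pow, Finset.card_filter, Nat.cast_add,
    Nat.cast_sum, ← Finset.sum_add_distrib]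
  refine Finset.sum_congr rfl fun i _ => ?_
  have h1 : m i ≤ S := hm ▸ Finset.single_le_sum (fun _ _ => Nat.zero_le _) (Finset.mem_univ i)
  rw [Finset.sum_add_distrib]
  congr 1
  · rw [Finset.sum_congr rfl (g := fun j => if a - 1 = j then (1 : ℚ) else 0)
      fun j _ => by congr 1; simp only [eq_iff_iff]; omega, Finset.sum_ite_eq]
    simp only [Finset.mem_range, Nat.cast_ite, Nat.cast_one, Nat.cast_zero]
    congr 1
    simp only [eq_iff_iff]; omega
  · rw [Finset.sum_congr rfl (g := fun j => if S - a = j then (1 : ℚ) else 0)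
      fun j hj => by
        have := Finset.mem_range.mp hj
        congr 1; simp only [eq_iff_iff]; omega, Finset.sum_ite_eq]
    simp only [Finset.mem_range, Nat.cast_ite, Nat.cast_one, Nat.cast_zero]
    congr 1
    simp only [eq_iff_iff]; omega

open Polynomial in
theorem card_add_card_eq_of_csf_eq {ι ι' : Type*} [Fintype ι] [Fintype ι'] {ℓ : ι → ℕ}
    {ℓ' : ι' → ℕ} (h : csf (spider ℓ) = csf (spider ℓ')) (S : ℕ) (hS : ∑ i, ℓ i = S)
    (hS' : ∑ i, ℓ' i = S) (a : ℕ) (ha : 1 ≤ a) (haS : a ≤ S) :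
    (Finset.univ.filter fun i => a ≤ ℓ i).card +
        (Finset.univ.filter fun i => S + 1 - a ≤ ℓ i).card =
      (Finset.univ.filter fun i => a ≤ ℓ' i).card +
        (Finset.univ.filter fun i => S + 1 - a ≤ ℓ' i).card := by
  have hp : ∑ i, ∑ j ∈ Finset.range (ℓ i), ((X : ℚ[X]) ^ (j + 1) + X ^ (S - j)) =
      ∑ i, ∑ j ∈ Finset.range (ℓ' i), (X ^ (j + 1) + X ^ (S - j)) := by
    refine Polynomial.eq_of_infinite_eval_eq _ _ (Set.Infinite.mono ?_
      (Set.finite_singleton (0 : ℚ)).infinite_compl)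
    intro q hq
    simpa [eval_finsetSum] using sum_pow_eq_of_csf_eq h S hS hS' hq
  have h1 := congrArg (fun p => coeff p a) hp
  beta_reduce at h1
  rw [coeff_sum_X_pow ℓ hS a ha haS, coeff_sum_X_pow ℓ' hS' a ha haS] at h1
  exact_mod_cast h1

/-- The number of indices `i` with `a ≤ ℓ i`. -/
noncomputable def countGE {ι : Type*} [Fintype ι] (ℓ : ι → ℕ) (a : ℕ) : ℕ :=
  (Finset.univ.filter fun i => a ≤ ℓ i).card

theorem countGE_anti {ι : Type*} [Fintype ι] (ℓ : ι → ℕ) {a b : ℕ} (hab : a ≤ b) :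
    countGE ℓ b ≤ countGE ℓ a :=
  Finset.card_le_card fun i hi => by
    simp only [Finset.mem_filter, Finset.mem_univ, true_and] at hi ⊢
    omega

theorem countGE_eq_zero {ι : Type*} [Fintype ι] (ℓ : ι → ℕ) {a : ℕ} (ha : ∑ i, ℓ i < a) :
    countGE ℓ a = 0 := by
  rw [countGE, Finset.card_eq_zero, Finset.filter_eq_empty_iff]
  intro i _
  have := Finset.single_le_sum (f := ℓ) (fun _ _ => Nat.zero_le _) (Finset.mem_univ i)
  omega

theorem countGE_not_lt {ι ι' : Type*} [Fintype ι] [Fintype ι'] {ℓ : ι → ℕ} {ℓ' : ι' → ℕ} {S b : ℕ}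
    (hpos : ∀ i, 1 ≤ ℓ' i) (hcard : 3 ≤ Fintype.card ι') (hS : ∑ i, ℓ' i = S)
    (h : ∀ a, 1 ≤ a → a ≤ S →
      countGE ℓ a + countGE ℓ (S + 1 - a) = countGE ℓ' a + countGE ℓ' (S + 1 - a))
    (hb : S + 1 < 2 * b) (hsucc : countGE ℓ (b + 1) = countGE ℓ' (b + 1)) :
    ¬ countGE ℓ b < countGE ℓ' b := by
  intro hlt
  have pair : ∀ i j, i ≠ j → ℓ' i + ℓ' j + 1 ≤ S := by
    intro i j hij
    obtain ⟨k, hk⟩ : ∃ k, k ∉ ({i, j} : Finset ι') := by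
      by_contra! hall
      have := Finset.card_le_card (fun k _ => hall k : Finset.univ ⊆ ({i, j} : Finset ι'))
      have := Finset.card_le_two (a := i) (b := j)
      rw [Finset.card_univ] at *
      omega
    have := Finset.sum_le_univ_sum_of_nonneg (f := ℓ') (s := insert k {i, j})
      (fun _ => Nat.zero_le _)
    rw [Finset.sum_insert hk, Finset.sum_pair hij] at this
    have := hpos k
    omega
  have hle : countGE ℓ' b ≤ 1 := by
    rw [countGE, Finset.card_le_one]
    intro i hi j hj
    by_contra hij
    have := pair i j hij
    simp only [Finset.mem_filter, Finset.mem_univ, true_and] at hi hj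
    omega
  obtain ⟨i, hi⟩ : ∃ i, b ≤ ℓ' i := by
    obtain ⟨i, hi⟩ := Finset.card_pos.mp (show 0 < countGE ℓ' b by omega)
    exact ⟨i, (Finset.mem_filter.mp hi).2⟩
  have : Nontrivial ι' := Fintype.one_lt_card_iff_nontrivial.mp (by omega)
  obtain ⟨i', hi'⟩ := exists_ne i
  have hbS := pair i i' hi'.symm
  have := hpos i'
  have h1 := h (S + 1 - b) (by omega) (by omega)
  have h2 := h (S - b) (by omega) (by omega)
  rw [show S + 1 - (S + 1 - b) = b by omega] at h1
  rw [show S + 1 - (S - b) = b + 1 by omega] at h2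
  have h3 := countGE_anti ℓ' (show S + 1 - b ≤ b by omega)
  have h4 := countGE_anti ℓ (show S - b ≤ S + 1 - b by omega)
  obtain ⟨j, hj, hji⟩ := Finset.exists_mem_ne (show 1 < countGE ℓ' (S - b) by omega) i
  have := pair i j hji.symm
  have := (Finset.mem_filter.mp hj).2
  omega

theorem countGE_eq {ι ι' : Type*} [Fintype ι] [Fintype ι'] {ℓ : ι → ℕ} {ℓ' : ι' → ℕ} {S : ℕ}
    (hpos : ∀ i, 1 ≤ ℓ i) (hcard : 3 ≤ Fintype.card ι) (hS : ∑ i, ℓ i = S)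
    (hpos' : ∀ i, 1 ≤ ℓ' i) (hcard' : 3 ≤ Fintype.card ι') (hS' : ∑ i, ℓ' i = S)
    (h : ∀ a, 1 ≤ a → a ≤ S →
      countGE ℓ a + countGE ℓ (S + 1 - a) = countGE ℓ' a + countGE ℓ' (S + 1 - a))
    (a : ℕ) (ha : 1 ≤ a) : countGE ℓ a = countGE ℓ' a := by
  induction hk : S - a using Nat.strong_induction_on generalizing a with
  | _ k ih =>
    have larger : ∀ b, a < b → countGE ℓ b = countGE ℓ' b := by
      intro b hb
      rcases lt_or_ge S b with hSb | hSb
      · rw [countGE_eq_zero ℓ (by omega), countGE_eq_zero ℓ' (by omega)]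
      · exact ih (S - b) (by omega) b (by omega) rfl
    rcases lt_or_ge S a with hSa | hSa
    · rw [countGE_eq_zero ℓ (by omega), countGE_eq_zero ℓ' (by omega)]
    have haS := h a ha hSa
    rcases lt_trichotomy (S + 1) (2 * a) with h1 | h1 | h1
    · have := countGE_not_lt hpos' hcard' hS' h h1 (larger _ (by omega))
      have := countGE_not_lt hpos hcard hS (fun a ha ha' => (h a ha ha').symm) h1
        (larger _ (by omega)).symm
      omega
    · rw [show S + 1 - a = a by omega] at haS
      omega
    · have := larger (S + 1 - a) (by omega)
      omega

theorem card_fiber_add_countGE {κ : Type*} [Fintype κ] (m : κ → ℕ) (a : ℕ) :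
    Fintype.card {i // m i = a} + countGE m (a + 1) = countGE m a := by
  rw [Fintype.card_subtype, countGE, countGE, ← Finset.card_union_of_disjoint]
  · congr 1
    ext i
    simp only [Finset.mem_union, Finset.mem_filter, Finset.mem_univ, true_and]
    omega
  · rw [Finset.disjoint_filter]
    intro i _
    omega

theorem exists_equiv_of_countGE_eq {ι ι' : Type*} [Fintype ι] [Fintype ι'] {ℓ : ι → ℕ}
    {ℓ' : ι' → ℕ} (h : ∀ a, countGE ℓ a = countGE ℓ' a) : ∃ σ : ι ≃ ι', ∀ i, ℓ' (σ i) = ℓ i := by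
  have hfib : ∀ a, Nonempty ({i // ℓ i = a} ≃ {i // ℓ' i = a}) := fun a => by
    refine Fintype.card_eq.mp ?_
    have h1 := card_fiber_add_countGE ℓ a
    have h2 := card_fiber_add_countGE ℓ' a
    rw [← h, ← h] at h2
    omega
  have e := fun a => Classical.choice (hfib a)
  refine ⟨(Equiv.sigmaFiberEquiv ℓ).symm.trans
    ((Equiv.sigmaCongrRight e).trans (Equiv.sigmaFiberEquiv ℓ')), fun i => ?_⟩
  exact (e (ℓ i) ⟨i, rfl⟩).2

theorem spider_iso_of_equiv {ι ι' : Type*} {ℓ : ι → ℕ} {ℓ' : ι' → ℕ} (σ : ι ≃ ι')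
    (h : ∀ i, ℓ' (σ i) = ℓ i) : Nonempty (spider ℓ ≃g spider ℓ') := by
  let e : (Σ i, Fin (ℓ i)) ≃ (Σ i, Fin (ℓ' i)) :=
    Equiv.sigmaCongr σ fun i => finCongr (h i).symm
  have hp : ∀ x, spiderParent ℓ' (e x) = (spiderParent ℓ x).map e := by
    rintro ⟨i, j⟩
    unfold spiderParent
    by_cases hj : j.1 = 0
    · rw [dif_pos (show (e ⟨i, j⟩).2.1 = 0 from hj), dif_pos hj]
      rfl
    · rw [dif_neg (show ¬(e ⟨i, j⟩).2.1 = 0 from hj), dif_neg hj]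
      rfl
  have he : Function.Injective (Option.map e) := Option.map_injective e.injective
  refine ⟨⟨Equiv.optionCongr e, ?_⟩⟩
  have hx : ∀ u v, (∃ x, Option.map e u = some x ∧ Option.map e v = spiderParent ℓ' x) ↔
      ∃ x, u = some x ∧ v = spiderParent ℓ x := by
    intro u v
    constructor
    · rintro ⟨x, hu, hv⟩
      obtain ⟨y, rfl⟩ := e.surjective x
      exact ⟨y, he hu, he (hv.trans (hp y))⟩
    · rintro ⟨x, rfl, rfl⟩
      exact ⟨e x, rfl, (hp x).symm⟩
  intro u v
  exact or_congr (hx u v) (hx v u)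

namespace SimpleGraph.IsTree

variable {V : Type*} {T : SimpleGraph V}

theorem exists_adj_dist_eq (hT : T.IsTree) {c v : V} (hv : v ≠ c) :
    ∃ w, T.Adj w v ∧ T.dist c v = T.dist c w + 1 := by
  obtain ⟨p, hp⟩ := hT.connected.exists_walk_length_eq_dist v c
  cases p with
  | nil => exact absurd rfl hv
  | @cons _ w _ h q =>
    refine ⟨w, h.symm, ?_⟩
    have h1 := SimpleGraph.dist_le q
    rw [SimpleGraph.Walk.length_cons] at hp
    rw [SimpleGraph.dist_comm (u := c), SimpleGraph.dist_comm (u := c)]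
    have h2 := hT.dist_eq_dist_add_one_of_adj c h
    rw [SimpleGraph.dist_comm (u := c), SimpleGraph.dist_comm (u := c)] at h2
    omega

theorem eq_of_adj_of_dist_eq (hT : T.IsTree) {c v w w' : V} (hw : T.Adj w v)
    (hw' : T.Adj w' v) (hd : T.dist c v = T.dist c w + 1) (hd' : T.dist c v = T.dist c w' + 1) :
    w = w' := by
  obtain ⟨p, hp⟩ := hT.connected.exists_walk_length_eq_dist c w
  obtain ⟨p', hp'⟩ := hT.connected.exists_walk_length_eq_dist c w'
  have h1 : (p.concat hw).IsPath := SimpleGraph.Walk.isPath_of_length_eq_dist _ (by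
    rw [SimpleGraph.Walk.length_concat, hp, hd])
  have h2 : (p'.concat hw').IsPath := SimpleGraph.Walk.isPath_of_length_eq_dist _ (by
    rw [SimpleGraph.Walk.length_concat, hp', hd'])
  have h3 := (hT.existsUnique_path c v).unique h1 h2
  have h4 := congrArg SimpleGraph.Walk.penultimate h3
  rwa [SimpleGraph.Walk.penultimate_concat, SimpleGraph.Walk.penultimate_concat] at h4

end SimpleGraph.IsTree

theorem eq_range_card_of_forall_succ_mem {s : Finset ℕ} (hs : ∀ n, n + 1 ∈ s → n ∈ s) :
    s = Finset.range s.card := by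
  have hle : ∀ k n, n + k ∈ s → n ∈ s := by
    intro k
    induction k with
    | zero => exact fun n h => h
    | succ k ih => exact fun n h => ih n (hs _ h)
  refine Finset.eq_of_subset_of_card_le (fun n hn => ?_) (by simp)
  have hsub : Finset.range (n + 1) ⊆ s := fun m hm => by
    have := Finset.mem_range.mp hm
    exact hle (n - m) m (by rwa [show m + (n - m) = n by omega])
  have := Finset.card_le_card hsub
  rw [Finset.card_range] at this
  exact Finset.mem_range.mpr this

theorem exists_iso_spider.{u} {V : Type u} [Fintype V] {T : SimpleGraph V} (hT : T.IsTree)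
    (hsp : ∃! v : V, 3 ≤ T.degree v) :
    ∃ (ι : Type u) (_ : Fintype ι) (ℓ : ι → ℕ), 3 ≤ Fintype.card ι ∧ (∀ i, 1 ≤ ℓ i) ∧
      Nonempty (T ≃g spider ℓ) := by
  obtain ⟨c, hc, hcu⟩ := hsp
  have hd0 : T.dist c c = 0 := SimpleGraph.dist_self
  have hpos : ∀ v, v ≠ c → 0 < T.dist c v := fun v hv => hT.connected.pos_dist_of_ne hv.symm
  have hp' : ∀ v, ∃ w, v ≠ c → T.Adj w v ∧ T.dist c v = T.dist c w + 1 := fun v => by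
    by_cases hv : v = c
    · exact ⟨c, fun h => absurd hv h⟩
    · obtain ⟨w, hw⟩ := hT.exists_adj_dist_eq hv
      exact ⟨w, fun _ => hw⟩
  choose p hp using hp'
  have hadj : ∀ u v, T.Adj u v ↔ (u ≠ c ∧ v = p u) ∨ (v ≠ c ∧ u = p v) := by
    have aux : ∀ u v, T.Adj u v → T.dist c u = T.dist c v + 1 → u ≠ c ∧ v = p u := by
      intro u v huv h
      have hu : u ≠ c := by
        rintro rfl
        omega
      exact ⟨hu, hT.eq_of_adj_of_dist_eq huv.symm (hp u hu).1 h (hp u hu).2⟩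
    intro u v
    constructor
    · intro huv
      rcases hT.dist_eq_dist_add_one_of_adj c huv with h | h
      · exact Or.inl (aux u v huv h)
      · exact Or.inr (aux v u huv.symm h)
    · rintro (⟨hu, rfl⟩ | ⟨hv, rfl⟩)
      · exact (hp u hu).1.symm
      · exact (hp v hv).1
  have hinj : ∀ u v, u ≠ c → v ≠ c → p u = p v → p u ≠ c → u = v := by
    intro u v hu hv huv hw
    by_contra hne
    refine hw (hcu _ ?_)
    have h1 := hp u hu
    have h2 := hp v hv
    have h3 := hp (p u) hw
    rw [← huv] at h2
    have hsub : ({u, v, p (p u)} : Finset V) ⊆ T.neighborFinset (p u) := by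
      intro x hx
      rw [SimpleGraph.mem_neighborFinset]
      simp only [Finset.mem_insert, Finset.mem_singleton] at hx
      rcases hx with rfl | rfl | rfl
      exacts [h1.1, h2.1, h3.1.symm]
    have hcard := Finset.card_le_card hsub
    rwa [Finset.card_eq_three.mpr ⟨u, v, p (p u), hne, ?_, ?_, rfl⟩,
      SimpleGraph.card_neighborFinset_eq_degree] at hcard
    · intro h
      rw [← h] at h3
      omega
    · intro h
      rw [← h] at h3
      omega
  have hpc : ∀ v, v ≠ c → (p v = c ↔ T.dist c v = 1) := by
    intro v hv
    have h1 := (hp v hv).2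
    constructor
    · intro h
      rw [h] at h1
      omega
    · intro h
      by_contra hne
      have := hpos _ hne
      omega
  obtain ⟨top, htop1, htop⟩ : ∃ top : V → V, (∀ v, T.dist c v = 1 → top v = v) ∧
      ∀ v, v ≠ c → p v ≠ c → top v = top (p v) := by
    refine ⟨fun v => p^[T.dist c v - 1] v, fun v hv => by simp [hv], fun v hv hpv => ?_⟩
    have h1 := (hp v hv).2
    have h2 := hpos _ hpv
    change p^[_] _ = p^[_] _
    rw [show T.dist c v - 1 = (T.dist c (p v) - 1) + 1 by omega, Function.iterate_succ_apply]
  have hne_of : ∀ v n, T.dist c v = n + 1 → v ≠ c := by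
    rintro v n h rfl
    omega
  have htopadj : ∀ n v, T.dist c v = n + 1 → T.Adj c (top v) := by
    intro n
    induction n with
    | zero =>
      intro v hv
      rw [htop1 v hv]
      exact SimpleGraph.dist_eq_one_iff_adj.mp hv
    | succ n ih =>
      intro v hv
      have hvc := hne_of v _ hv
      have h1 := (hp v hvc).2
      rw [htop v hvc (by rw [Ne, hpc v hvc]; omega)]
      exact ih _ (by omega)
  have htopinj : ∀ n u v, T.dist c u = n + 1 → T.dist c v = n + 1 → top u = top v → u = v := by
    intro n
    induction n with
    | zero =>
      intro u v hu hv h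
      rwa [htop1 u hu, htop1 v hv] at h
    | succ n ih =>
      intro u v hu hv h
      have huc := hne_of u _ hu
      have hvc := hne_of v _ hv
      have h1 := (hp u huc).2
      have h2 := (hp v hvc).2
      have hpu : p u ≠ c := by rw [Ne, hpc u huc]; omega
      rw [htop u huc hpu, htop v hvc (by rw [Ne, hpc v hvc]; omega)] at h
      exact hinj u v huc hvc (ih _ _ (by omega) (by omega) h) hpu
  let leg : V → Finset V := fun u => Finset.univ.filter fun v => v ≠ c ∧ top v = u
  have hmem : ∀ u v, v ∈ leg u ↔ v ≠ c ∧ top v = u := fun u v => by simp [leg]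
  let ℓ : {u // T.Adj c u} → ℕ := fun u => (leg u).card
  have hrange : ∀ u, (leg u).image (fun v => T.dist c v - 1) = Finset.range (leg u).card := by
    intro u
    have hcard : ((leg u).image (fun v => T.dist c v - 1)).card = (leg u).card := by
      refine Finset.card_image_of_injOn fun v hv w hw h => ?_
      have hv' := (hmem u v).mp hv
      have hw' := (hmem u w).mp hw
      have h1 := hpos v hv'.1
      have h2 := hpos w hw'.1
      change T.dist c v - 1 = T.dist c w - 1 at h
      exact htopinj (T.dist c v - 1) v w (by omega) (by omega) (hv'.2.trans hw'.2.symm)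
    rw [← hcard]
    refine eq_range_card_of_forall_succ_mem fun n hn => ?_
    obtain ⟨v, hv, hvn⟩ := Finset.mem_image.mp hn
    have hv' := (hmem u v).mp hv
    have h1 := (hp v hv'.1).2
    have hpv : p v ≠ c := by rw [Ne, hpc v hv'.1]; omega
    exact Finset.mem_image.mpr ⟨p v, (hmem _ _).mpr ⟨hpv, by rw [← htop v hv'.1 hpv, hv'.2]⟩,
      by omega⟩
  have hlt : ∀ v, v ≠ c → T.dist c v - 1 < (leg (top v)).card := by
    intro v hv
    rw [← Finset.mem_range, ← hrange]
    exact Finset.mem_image_of_mem _ ((hmem _ _).mpr ⟨hv, rfl⟩)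
  have hx : ∀ v, v ≠ c → ∃ x : Σ u, Fin (ℓ u), x.1.1 = top v ∧ x.2.1 = T.dist c v - 1 := by
    intro v hv
    have := hpos v hv
    exact ⟨⟨⟨top v, htopadj (T.dist c v - 1) v (by omega)⟩, ⟨T.dist c v - 1, hlt v hv⟩⟩, rfl, rfl⟩
  choose x hx1 hx2 using hx
  have hext : ∀ y z : Σ u, Fin (ℓ u), y.1.1 = z.1.1 → y.2.1 = z.2.1 → y = z := by
    rintro ⟨⟨u, hu⟩, ⟨j, hj⟩⟩ ⟨⟨u', hu'⟩, ⟨j', hj'⟩⟩ h1 h2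
    simp only at h1 h2
    subst h1 h2
    rfl
  let F : V → Option (Σ u, Fin (ℓ u)) := fun v => if h : v = c then none else some (x v h)
  have hFc : F c = none := dif_pos rfl
  have hF : ∀ v (hv : v ≠ c), F v = some (x v hv) := fun v hv => dif_neg hv
  have hFinj : Function.Injective F := by
    intro u v huv
    by_cases hu : u = c <;> by_cases hv : v = c
    · rw [hu, hv]
    · rw [hu, hFc, hF v hv] at huv
      cases huv
    · rw [hv, hFc, hF u hu] at huv
      cases huv
    · rw [hF u hu, hF v hv, Option.some.injEq] at huv
      have h1 := hpos u hu
      have h2 := hpos v hv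
      have h3 := hx2 u hu
      rw [huv, hx2 v hv] at h3
      exact htopinj (T.dist c u - 1) u v (by omega) (by omega) (by rw [← hx1 u hu, huv, hx1])
  have hFsurj : Function.Surjective F := by
    rintro (_ | ⟨⟨u, hu⟩, ⟨j, hj⟩⟩)
    · exact ⟨c, hFc⟩
    · have hj' : j ∈ (leg u).image (fun v => T.dist c v - 1) := by
        rw [hrange]
        exact Finset.mem_range.mpr hj
      obtain ⟨v, hv, hvj⟩ := Finset.mem_image.mp hj'
      have hv' := (hmem u v).mp hv
      refine ⟨v, ?_⟩
      rw [hF v hv'.1]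
      exact congrArg some (hext _ _ ((hx1 v hv'.1).trans hv'.2) ((hx2 v hv'.1).trans hvj))
  have hpar : ∀ v (hv : v ≠ c), F (p v) = spiderParent ℓ (x v hv) := by
    intro v hv
    have h1 := (hp v hv).2
    have h2 := hx2 v hv
    by_cases hpv : p v = c
    · have := (hpc v hv).mp hpv
      rw [hpv, hFc, spiderParent, dif_pos (by omega)]
    · have := hpos _ hpv
      rw [hF _ hpv, spiderParent, dif_neg (by omega)]
      refine congrArg some (hext _ _ ?_ ?_)
      · rw [hx1, hx1, htop v hv hpv]
      · simp only [hx2]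
        omega
  refine ⟨{u // T.Adj c u}, inferInstance, ℓ, ?_, ?_, ⟨⟨Equiv.ofBijective F ⟨hFinj, hFsurj⟩, ?_⟩⟩⟩
  · rw [← SimpleGraph.card_neighborFinset_eq_degree] at hc
    refine hc.trans_eq ?_
    rw [Fintype.card_subtype]
    congr 1
    ext v
    simp
  · rintro ⟨u, hu⟩
    exact Finset.card_pos.mpr ⟨u, (hmem u u).mpr
      ⟨hu.ne', htop1 u (SimpleGraph.dist_eq_one_iff_adj.mpr hu)⟩⟩
  · have key : ∀ u v, (∃ y, F u = some y ∧ F v = spiderParent ℓ y) ↔ u ≠ c ∧ v = p u := by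
      intro u v
      constructor
      · rintro ⟨y, hu, hv⟩
        have huc : u ≠ c := by
          rintro rfl
          rw [hFc] at hu
          cases hu
        rw [hF u huc, Option.some.injEq] at hu
        rw [← hu, ← hpar] at hv
        exact ⟨huc, hFinj hv⟩
      · rintro ⟨hu, rfl⟩
        exact ⟨x u hu, hF u hu, hpar u hu⟩
    intro u v
    rw [hadj]
    exact or_congr (key u v) (key v u)

theorem stmt12 {V V' : Type*} [Fintype V] [Fintype V']
    (T : SimpleGraph V) (T' : SimpleGraph V') (hT : T.IsTree) (hT' : T'.IsTree)
    (hsp : ∃! v : V, 3 ≤ T.degree v) (hsp' : ∃! v : V', 3 ≤ T'.degree v)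
    (h : csf T = csf T') :
    Nonempty (T ≃g T') := by
  obtain ⟨ι, _, ℓ, hcard, hpos, ⟨φ⟩⟩ := exists_iso_spider hT hsp
  obtain ⟨ι', _, ℓ', hcard', hpos', ⟨φ'⟩⟩ := exists_iso_spider hT' hsp'
  have hV : Fintype.card V = ∑ i, ℓ i + 1 := by simp [Fintype.card_congr φ.toEquiv]
  have hV' : Fintype.card V' = ∑ i, ℓ' i + 1 := by simp [Fintype.card_congr φ'.toEquiv]
  have hn := card_eq_of_csf_eq h
  have hsum : ∑ i, ℓ' i = ∑ i, ℓ i := by omega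
  have hge := countGE_eq hpos hcard rfl hpos' hcard' hsum
    (card_add_card_eq_of_csf_eq (((csf_congr_iso φ).symm.trans h).trans (csf_congr_iso φ')) _ rfl
      hsum)
  obtain ⟨σ, hσ⟩ := exists_equiv_of_countGE_eq (ℓ := ℓ) (ℓ' := ℓ') fun a => by
    rcases Nat.eq_zero_or_pos a with rfl | ha
    · have h1 := hge 1 le_rfl
      simp only [countGE, hpos, hpos', Nat.zero_le] at h1 ⊢
      exact h1
    · exact hge a ha
  obtain ⟨ψ⟩ := spider_iso_of_equiv σ hσ
  exact ⟨(φ.trans ψ).trans φ'.symm⟩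
end
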